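/- arXiv:2307.05712 — 2 statements merged into one kernel-verified Lean document; each statement's English description precedes it below -/
import Mathlib

section
/- Let F ∈ ℤ[x,y] have total degree 4 with F(0,0) = 0, write F = F_4 + F_3 + F_2 + F_1 with F_i the homogeneous degree-i part, suppose F_4 is positive semi-definite and gcd(F̃_4, F_3, F_2, F_1) ≠ 1. Then for every positive integer C and every integer D, F(ℤ²) ≠ (Cℤ)_{≥D} = {Cn : n ∈ ℤ, Cn ≥ D}. -/
open MvPolynomial

/-- Evaluation of an integer polynomial in two variables at a real point. -/
noncomputable def evalReal (G : MvPolynomial (Fin 2) ℤ) (x y : ℝ) : ℝ :=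
  MvPolynomial.aeval ![x, y] G

/-- An integral binary form (or polynomial) is positive semi-definite if it is
nonnegative at every real point. -/
def PosSemidef2 (G : MvPolynomial (Fin 2) ℤ) : Prop :=
  ∀ x y : ℝ, 0 ≤ evalReal G x y

/-- Positive definite: positive at every nonzero real point. -/
def PosDef2 (G : MvPolynomial (Fin 2) ℤ) : Prop :=
  ∀ x y : ℝ, (x, y) ≠ (0, 0) → 0 < evalReal G x y

/-- A primitive integral polynomial: the gcd of its coefficients is a unit. -/
def IsPrimitiveInt (G : MvPolynomial (Fin 2) ℤ) : Prop :=
  ∀ d : ℤ, (∀ m, d ∣ MvPolynomial.coeff m G) → IsUnit d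

/-- The image of an integral polynomial in `ℚ[x,y]`. -/
noncomputable def toQ (G : MvPolynomial (Fin 2) ℤ) : MvPolynomial (Fin 2) ℚ :=
  MvPolynomial.map (Int.castRingHom ℚ) G

/-- `Ft4` is the polynomial `F̃₄ = F₄ / P₀`, where `P₀` is the positive definite integral
form of largest degree (possibly a positive constant) dividing `F₄` such that the quotient
is a primitive integral form. -/
def IsTildePart (F4 Ft4 : MvPolynomial (Fin 2) ℤ) : Prop :=
  ∃ (P0 : MvPolynomial (Fin 2) ℤ) (k : ℕ),
    P0.IsHomogeneous k ∧ PosDef2 P0 ∧ F4 = P0 * Ft4 ∧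
    (∃ n, Ft4.IsHomogeneous n) ∧ IsPrimitiveInt Ft4 ∧
    (∀ (P0' Ft4' : MvPolynomial (Fin 2) ℤ) (k' : ℕ),
      P0'.IsHomogeneous k' → PosDef2 P0' → F4 = P0' * Ft4' →
      (∃ n, Ft4'.IsHomogeneous n) → IsPrimitiveInt Ft4' → k' ≤ k)

/-- Two integral polynomials have a common non-constant factor over `ℚ`
(i.e. their gcd in `ℚ[x,y]` is not 1). -/
def CommonFactor2 (A B : MvPolynomial (Fin 2) ℤ) : Prop :=
  ∃ d : MvPolynomial (Fin 2) ℚ, 0 < d.totalDegree ∧ d ∣ toQ A ∧ d ∣ toQ B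

/-- Three integral polynomials have a common non-constant factor over `ℚ`. -/
def CommonFactor3 (A B C : MvPolynomial (Fin 2) ℤ) : Prop :=
  ∃ d : MvPolynomial (Fin 2) ℚ, 0 < d.totalDegree ∧ d ∣ toQ A ∧ d ∣ toQ B ∧ d ∣ toQ C

/-- Four integral polynomials have a common non-constant factor over `ℚ`. -/
def CommonFactor4 (A B C D : MvPolynomial (Fin 2) ℤ) : Prop :=
  ∃ d : MvPolynomial (Fin 2) ℚ, 0 < d.totalDegree ∧
    d ∣ toQ A ∧ d ∣ toQ B ∧ d ∣ toQ C ∧ d ∣ toQ D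

/-- The value set `F(ℤ²)`. -/
def valueSet (F : MvPolynomial (Fin 2) ℤ) : Set ℤ :=
  {m : ℤ | ∃ x y : ℤ, MvPolynomial.eval ![x, y] F = m}

/-- The set `(Cℤ)_{≥ D} = {Cn : n ∈ ℤ, Cn ≥ D}`. -/
def targetSet (C D : ℤ) : Set ℤ :=
  {m : ℤ | (∃ n : ℤ, m = C * n) ∧ D ≤ m}


lemma aux_cubic_lead (a b c D : ℤ) (h : ∀ t : ℤ, D ≤ a * t ^ 3 + b * t ^ 2 + c * t) : a = 0 := by
  obtain ⟨T, hT⟩ : ∃ T : ℤ, T = |b| + |c| + |D| + 1 := ⟨_, rfl⟩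
  have hb := abs_nonneg b
  have hc := abs_nonneg c
  have hD := abs_nonneg D
  have hb1 := le_abs_self b
  have hc1 := le_abs_self c
  have hc2 := neg_abs_le c
  have hD1 := neg_abs_le D
  have hT1 : 1 ≤ T := by linarith
  have hTT : T ≤ T ^ 2 := by nlinarith
  have e1 : b * T ^ 2 ≤ |b| * T ^ 2 := by gcongr
  have e2 : |c| * T ≤ |c| * T ^ 2 := by gcongr
  have e3 : T ^ 3 = |b| * T ^ 2 + |c| * T ^ 2 + (|D| + 1) * T ^ 2 := by
    rw [show T ^ 3 = T * T ^ 2 by ring]; nth_rewrite 1 [hT]; ring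
  have e4 : |D| + 1 ≤ (|D| + 1) * T ^ 2 := by nlinarith
  have e5 : c * T ≤ |c| * T := by gcongr
  have e6 : -(c * T) ≤ |c| * T := by nlinarith
  have hT3 : 0 ≤ T ^ 3 := by positivity
  rcases lt_trichotomy a 0 with ha | ha | ha
  · have := h T
    have : a * T ^ 3 ≤ -T ^ 3 := by nlinarith
    nlinarith
  · exact ha
  · have := h (-T)
    have : T ^ 3 ≤ a * T ^ 3 := by nlinarith
    nlinarith

lemma aux_lin_lead (b c D : ℤ) (h : ∀ t : ℤ, D ≤ b * t + c) : b = 0 := by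
  rcases lt_trichotomy b 0 with hb | hb | hb
  · have := h (|c| + |D| + 1)
    have := abs_nonneg c
    have := abs_nonneg D
    have := le_abs_self c
    have := neg_abs_le D
    nlinarith
  · exact hb
  · have := h (-(|c| + |D| + 1))
    have := abs_nonneg c
    have := abs_nonneg D
    have := le_abs_self c
    have := neg_abs_le D
    nlinarith

lemma aux_quad_lead (a b c D : ℤ) (h : ∀ t : ℤ, D ≤ a * t ^ 2 + b * t + c) : 0 ≤ a := by
  by_contra ha
  push Not at ha
  obtain ⟨T, hT⟩ : ∃ T : ℤ, T = |b| + |c| + |D| + 1 := ⟨_, rfl⟩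
  have hb := abs_nonneg b
  have hc := abs_nonneg c
  have hD := abs_nonneg D
  have hb1 := le_abs_self b
  have hc1 := le_abs_self c
  have hD1 := neg_abs_le D
  have hT1 : 1 ≤ T := by linarith
  have := h T
  have e1 : b * T ≤ |b| * T := by gcongr
  have e2 : |c| ≤ |c| * T := by nlinarith
  have e3 : T ^ 2 = |b| * T + |c| * T + (|D| + 1) * T := by
    rw [show T ^ 2 = T * T by ring]; nth_rewrite 1 [hT]; ring
  have e4 : |D| + 1 ≤ (|D| + 1) * T := by nlinarith
  have : a * T ^ 2 ≤ -T ^ 2 := by nlinarith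
  nlinarith

lemma aux_summable_sq : Summable (fun y : ℤ => (1 : ℝ) / ((y : ℝ) ^ 2 + 1)) := by
  have h1 : Summable (fun y : ℤ => (1 : ℝ) / ((y : ℝ) ^ 2)) :=
    Real.summable_one_div_int_pow.mpr (by norm_num)
  have h2 : Summable (fun y : ℤ => (1 : ℝ) / ((y : ℝ) ^ 2) + (if y = 0 then 1 else 0)) :=
    h1.add (summable_of_ne_finset_zero (s := {0}) (by intro b hb; simpa using hb))
  refine h2.of_nonneg_of_le (fun y => by positivity) (fun y => ?_)
  by_cases hy : y = 0
  · simp [hy]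
  · have : (0 : ℝ) < (y : ℝ) ^ 2 := by positivity
    simp only [hy, if_false, add_zero]
    gcongr
    linarith

/-- Integers `n` such that `C n` is a value of a fixed quadratic have summable reciprocals. -/
lemma aux_quad_summable (A B E C D : ℤ) (hC : 0 < C)
    (h : ∀ t : ℤ, D ≤ A * t ^ 2 + B * t + E) :
    Summable (Set.indicator {n : ℕ | 0 < n ∧ ∃ y : ℤ, A * y ^ 2 + B * y + E = C * n}
      (fun n : ℕ => (1 : ℝ) / n)) := by
  rw [← summable_subtype_iff_indicator]
  have hA := aux_quad_lead A B E D h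
  rcases hA.eq_or_lt with hA | hA
  · subst hA
    have hB := aux_lin_lead B E D (by simpa using h)
    subst hB
    have : Finite {n : ℕ | 0 < n ∧ ∃ y : ℤ, 0 * y ^ 2 + 0 * y + E = C * n} := by
      apply Set.Finite.to_subtype
      apply Set.Subsingleton.finite
      rintro n ⟨_, y, hy⟩ m ⟨_, z, hz⟩
      have : C * (n : ℤ) = C * m := by linarith
      exact_mod_cast mul_left_cancel₀ hC.ne' this
    exact Summable.of_finite
  · have hex : ∀ n : {n : ℕ | 0 < n ∧ ∃ y : ℤ, A * y ^ 2 + B * y + E = C * n},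
      ∃ y : ℤ, A * y ^ 2 + B * y + E = C * (n : ℕ) := fun n => n.2.2
    choose f hf using hex
    have hinj : Function.Injective f := by
      intro n m hnm
      have h1 := hf n
      have h2 := hf m
      rw [hnm] at h1
      have : C * ((n : ℕ) : ℤ) = C * (m : ℕ) := by linarith
      apply Subtype.ext
      exact_mod_cast mul_left_cancel₀ hC.ne' this
    have hs := (aux_summable_sq.comp_injective hinj).mul_left
      ((2 * C + B ^ 2 + 2 * |E| + 1 : ℤ) : ℝ)
    refine hs.of_nonneg_of_le (fun n => by simp only [Function.comp]; positivity) (fun n => ?_)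
    have hn : (1 : ℤ) ≤ (n : ℕ) := by exact_mod_cast n.2.1
    have key : f n ^ 2 + 1 ≤ (2 * C + B ^ 2 + 2 * |E| + 1) * (n : ℕ) := by
      have h1 := hf n
      have h2 : f n ^ 2 ≤ A * f n ^ 2 := by nlinarith [sq_nonneg (f n)]
      have h3 : 0 ≤ (f n + B) ^ 2 := sq_nonneg _
      have h4 := neg_abs_le E
      have h5 := abs_nonneg E
      have h6 := sq_nonneg B
      nlinarith
    have key' : (f n : ℝ) ^ 2 + 1 ≤ ((2 * C + B ^ 2 + 2 * |E| + 1 : ℤ) : ℝ) * (n : ℕ) := by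
      exact_mod_cast key
    have hn' : (0 : ℝ) < (n : ℕ) := by exact_mod_cast n.2.1
    simp only [Function.comp]
    rw [mul_one_div, div_le_div_iff₀ hn' (by positivity)]
    linarith

/-- Finitely many quadratics do not cover all large primes. -/
lemma aux_prime_escape (A B E : ℤ → ℤ) (s : Finset ℤ) (C D : ℤ) (hC : 0 < C)
    (h : ∀ x ∈ s, ∀ t : ℤ, D ≤ A x * t ^ 2 + B x * t + E x) (N : ℕ) :
    ∃ p : ℕ, p.Prime ∧ N ≤ p ∧ ∀ x ∈ s, ∀ y : ℤ, A x * y ^ 2 + B x * y + E x ≠ C * p := by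
  by_contra! hcon
  apply not_summable_one_div_on_primes
  have h1 : Summable (fun n : ℕ => ∑ x ∈ s,
      (Set.indicator {n : ℕ | 0 < n ∧ ∃ y : ℤ, A x * y ^ 2 + B x * y + E x = C * n}
      (fun n : ℕ => (1 : ℝ) / n)) n) :=
    summable_sum (fun x hx => aux_quad_summable _ _ _ C D hC (h x hx))
  have h2 : Summable (fun n : ℕ => if n < N then (1 : ℝ) / n else 0) :=
    summable_of_ne_finset_zero (s := Finset.range N) (by intro b hb; simp at hb; simp [hb])
  have hnn : ∀ x ∈ s, ∀ n : ℕ, 0 ≤ (Set.indicator {n : ℕ | 0 < n ∧ ∃ y : ℤ, A x * y ^ 2 + B x * y + E x = C * n}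
      (fun n : ℕ => (1 : ℝ) / n)) n := fun x _ n => Set.indicator_nonneg (fun _ _ => by positivity) n
  refine (h1.add h2).of_nonneg_of_le
    (fun n => Set.indicator_nonneg (fun _ _ => by positivity) n) (fun n => ?_)
  by_cases hp : n.Prime
  · rw [Set.indicator_of_mem (by exact hp)]
    by_cases hN : n < N
    · simp only [hN, if_true]
      have := Finset.sum_nonneg (fun x hx => hnn x hx n)
      linarith
    · obtain ⟨x, hx, y, hy⟩ := hcon n hp (by omega)
      have := Finset.single_le_sum (fun x hx => hnn x hx n) hx
      rw [Set.indicator_of_mem (by exact ⟨hp.pos, y, hy⟩)] at this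
      simp only [hN, if_false]
      linarith
  · rw [Set.indicator_of_notMem (by exact hp)]
    have := Finset.sum_nonneg (fun x hx => hnn x hx n)
    have : (0 : ℝ) ≤ if n < N then (1 : ℝ) / n else 0 := by split_ifs <;> positivity
    linarith

lemma aux_tri (A B0 B1 B2 B3 B4 k : ℤ) : |A| ≤
    |A + (B0 + B1 + B2) + (B3 + B4) + k| + |B0| + |B1| + |B2| + |B3| + |B4| + |k| := by
  have h1 := le_abs_self (A + (B0 + B1 + B2) + (B3 + B4) + k)
  have h2 := neg_abs_le (A + (B0 + B1 + B2) + (B3 + B4) + k)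
  rw [abs_le]
  constructor <;> linarith [le_abs_self B0, neg_abs_le B0, le_abs_self B1, neg_abs_le B1,
    le_abs_self B2, neg_abs_le B2, le_abs_self B3, neg_abs_le B3, le_abs_self B4, neg_abs_le B4,
    le_abs_self k, neg_abs_le k]

/-- The large-`x` lemma, nondegenerate quadratic form. -/
lemma aux_large_pos (a Δ q0 q1 q2 l0 l1 k C : ℤ) (ha : 0 < a) (hΔ : 0 < Δ) :
    ∃ X : ℤ, ∀ x u : ℤ, X ≤ |x| →
      C < |a * x * (u ^ 2 + Δ * x ^ 2) + (q0 * x ^ 2 + q1 * x * u + q2 * u ^ 2)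
        + (l0 * x + l1 * u) + k| := by
  refine ⟨|q0| + |q1| + |q2| + |l0| + |l1| + |k| + |C| + 1, fun x u hx => ?_⟩
  have h0 := abs_nonneg q0
  have h1 := abs_nonneg q1
  have h2 := abs_nonneg q2
  have h3 := abs_nonneg l0
  have h4 := abs_nonneg l1
  have h5 := abs_nonneg k
  have h6 := abs_nonneg C
  have h7 := le_abs_self C
  have hx1 : 1 ≤ |x| := by linarith
  have hxx : |x| ≤ |x| ^ 2 := by nlinarith
  obtain ⟨X, hX⟩ : ∃ X, X = |x| := ⟨_, rfl⟩
  obtain ⟨U, hU⟩ : ∃ U, U = |u| := ⟨_, rfl⟩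
  have hU0 : 0 ≤ U := hU ▸ abs_nonneg u
  have sx : x ^ 2 = X ^ 2 := by rw [hX, sq_abs]
  have su : u ^ 2 = U ^ 2 := by rw [hU, sq_abs]
  rw [← hX] at hx hx1 hxx
  have m1 : |a * x * (u ^ 2 + Δ * x ^ 2)| = a * X * (U ^ 2 + Δ * X ^ 2) := by
    rw [abs_mul, abs_mul, abs_of_pos ha, ← hX, sx, su, abs_of_nonneg]; positivity
  have m2 : X * (U ^ 2 + X ^ 2) ≤ a * X * (U ^ 2 + Δ * X ^ 2) := by
    have : U ^ 2 + X ^ 2 ≤ U ^ 2 + Δ * X ^ 2 := by nlinarith [sq_nonneg X]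
    calc X * (U ^ 2 + X ^ 2) ≤ X * (U ^ 2 + Δ * X ^ 2) := by gcongr
      _ ≤ a * (X * (U ^ 2 + Δ * X ^ 2)) := le_mul_of_one_le_left (by positivity) (by omega)
      _ = _ := by ring
  set S := U ^ 2 + X ^ 2 with hS
  have hS1 : 1 ≤ S := by nlinarith
  have hXU : X * U ≤ S := by nlinarith [sq_nonneg (X - U)]
  have hUS : U ≤ S := by nlinarith [sq_nonneg (U - 1)]
  have hX2S : X ^ 2 ≤ S := by linarith [sq_nonneg U]
  have hXS : X ≤ S := by linarith
  have hU2S : U ^ 2 ≤ S := by linarith [sq_nonneg X]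
  have n0 : |q0 * x ^ 2| ≤ |q0| * S := by rw [abs_mul, abs_of_nonneg (sq_nonneg x), sx]; gcongr
  have n1 : |q1 * x * u| ≤ |q1| * S := by
    rw [mul_assoc, abs_mul, abs_mul, ← hX, ← hU]; gcongr
  have n2 : |q2 * u ^ 2| ≤ |q2| * S := by rw [abs_mul, abs_of_nonneg (sq_nonneg u), su]; gcongr
  have n3 : |l0 * x| ≤ |l0| * S := by rw [abs_mul, ← hX]; gcongr
  have n4 : |l1 * u| ≤ |l1| * S := by rw [abs_mul, ← hU]; gcongr
  have n5 : |k| ≤ |k| * S := by nlinarith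
  have n6 : (|q0| + |q1| + |q2| + |l0| + |l1| + |k| + |C| + 1) * S ≤ X * S := by gcongr
  have n7 : |C| + 1 ≤ (|C| + 1) * S := by nlinarith
  have n8 : (|q0| + |q1| + |q2| + |l0| + |l1| + |k|) * S + (|C| + 1) * S ≤ X * S := by linarith
  have tri : |a * x * (u ^ 2 + Δ * x ^ 2)| ≤
      |a * x * (u ^ 2 + Δ * x ^ 2) + (q0 * x ^ 2 + q1 * x * u + q2 * u ^ 2)
        + (l0 * x + l1 * u) + k| + |q0 * x ^ 2| + |q1 * x * u| + |q2 * u ^ 2| + |l0 * x|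
        + |l1 * u| + |k| := aux_tri _ _ _ _ _ _ _
  rw [m1] at tri
  linarith

/-- The large-`x` lemma, degenerate quadratic form. -/
lemma aux_large_deg (a q1 q2 l0 l1 k C : ℤ) (ha : 0 < a) :
    ∃ X : ℤ, ∀ x u : ℤ, X ≤ |x| → a * u ^ 2 + q1 * u + l0 ≠ 0 →
      C < |x * (a * u ^ 2 + q1 * u + l0) + (q2 * u ^ 2 + l1 * u + k)| := by
  refine ⟨|C| + |l1| + |k| + (|q2| + |l1|) * (2 + q1 ^ 2 + 2 * |l0|) + 1, fun x u hx hR => ?_⟩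
  set R := a * u ^ 2 + q1 * u + l0 with hRdef
  have h0 := abs_nonneg l0
  have h2 := abs_nonneg q2
  have h4 := abs_nonneg l1
  have h5 := abs_nonneg k
  have h6 := abs_nonneg C
  have h7 := le_abs_self C
  have hR1 : 1 ≤ |R| := Int.one_le_abs hR
  have b1 : u ^ 2 ≤ (2 + q1 ^ 2 + 2 * |l0|) * |R| := by
    have e1 : u ^ 2 ≤ a * u ^ 2 := by nlinarith [sq_nonneg u]
    have e2 := le_abs_self R
    have e3 := neg_abs_le l0
    have e4 := sq_nonneg (u + q1)
    have e5 := sq_nonneg q1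
    nlinarith
  have b2 : |u| ≤ 1 + u ^ 2 := by
    rw [← sq_abs u]; nlinarith [abs_nonneg u, sq_nonneg (|u| - 1)]
  have b3 : |q2 * u ^ 2| ≤ |q2| * ((2 + q1 ^ 2 + 2 * |l0|) * |R|) := by
    rw [abs_mul, abs_of_nonneg (sq_nonneg u)]; gcongr
  have b4 : |l1 * u| ≤ |l1| * (|R| + (2 + q1 ^ 2 + 2 * |l0|) * |R|) := by
    rw [abs_mul]; gcongr; linarith
  have b5 : |k| ≤ |k| * |R| := by nlinarith
  have b6 : |C| + 1 ≤ (|C| + 1) * |R| := by nlinarith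
  have b7 : (|C| + |l1| + |k| + (|q2| + |l1|) * (2 + q1 ^ 2 + 2 * |l0|) + 1) * |R| ≤ |x| * |R| := by
    gcongr
  rw [← abs_mul] at b7
  have tri : |x * R| ≤ |x * R + (q2 * u ^ 2 + l1 * u + k)| + |q2 * u ^ 2| + |l1 * u| + |k| := by
    generalize x * R = A
    generalize q2 * u ^ 2 = B2
    generalize l1 * u = B4
    clear * -
    simp only [abs_eq_max_neg]
    omega
  nlinarith

lemma aux_large_cubic (g b c k C : ℤ) (hg : 0 < g) :
    ∃ X : ℤ, ∀ x : ℤ, X ≤ |x| → C < |g * x ^ 3 + b * x ^ 2 + c * x + k| := by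
  obtain ⟨X, hX⟩ := aux_large_pos 1 g b 0 0 c 0 k C one_pos hg
  refine ⟨X, fun x hx => ?_⟩
  have := hX x 0 hx
  convert this using 2
  ring

/-- If `F = x G` satisfies the hypotheses then `G` is zero or large when `|x|` is large. -/
lemma aux_large (α δ γ β β2 β3 l1 l2 c C D : ℤ)
    (hpos : ∀ x y : ℤ, 0 ≤ x ^ 2 * (α * y ^ 2 + δ * x * y + γ * x ^ 2))
    (hne : ¬ (α = 0 ∧ δ = 0 ∧ γ = 0))
    (hlow : ∀ x y : ℤ, D ≤ x * (x * (α * y ^ 2 + δ * x * y + γ * x ^ 2)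
      + (β * y ^ 2 + β2 * x * y + β3 * x ^ 2) + (l1 * y + l2 * x) + c)) :
    ∃ X : ℤ, ∀ x y : ℤ, X ≤ |x| → (x * (α * y ^ 2 + δ * x * y + γ * x ^ 2)
      + (β * y ^ 2 + β2 * x * y + β3 * x ^ 2) + (l1 * y + l2 * x) + c) ≠ 0 →
      C < |x * (α * y ^ 2 + δ * x * y + γ * x ^ 2)
      + (β * y ^ 2 + β2 * x * y + β3 * x ^ 2) + (l1 * y + l2 * x) + c| := by
  have hα : 0 ≤ α := aux_quad_lead α δ γ 0 (fun t => by have := hpos 1 t; linarith)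
  rcases hα.eq_or_lt with hα | hα
  · subst hα
    have hδ : δ = 0 := aux_lin_lead δ γ 0 (fun t => by have := hpos 1 t; linarith)
    subst hδ
    have hγ : 0 < γ := by
      have := hpos 1 0
      have : γ ≠ 0 := fun h => hne ⟨rfl, rfl, h⟩
      have : 0 ≤ γ := by linarith
      omega
    have hβ1 : 0 ≤ β := aux_quad_lead β (β2 + l1) (γ + β3 + l2 + c) D
      (fun t => by have := hlow 1 t; linarith)
    have hβ2 : 0 ≤ -β := aux_quad_lead (-β) (β2 - l1) (γ - β3 + l2 - c) D
      (fun t => by have := hlow (-1) t; linarith)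
    have hβ : β = 0 := by omega
    subst hβ
    have h1 : β2 + l1 = 0 := aux_lin_lead (β2 + l1) (γ + β3 + l2 + c) D
      (fun t => by have := hlow 1 t; linarith)
    have h2 : β2 - l1 = 0 := aux_lin_lead (β2 - l1) (γ - β3 + l2 - c) D
      (fun t => by have := hlow (-1) t; linarith)
    have h3 : β2 = 0 := by omega
    have h4 : l1 = 0 := by omega
    subst h3 h4
    obtain ⟨X, hX⟩ := aux_large_cubic γ β3 l2 c C hγ
    refine ⟨X, fun x y hx _ => ?_⟩
    convert hX x hx using 2
    ring
  · have hΔ : 0 ≤ 4 * α * γ - δ ^ 2 := by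
      have := hpos (2 * α) (-δ)
      have h2 : (0 : ℤ) < 4 * α ^ 3 := by positivity
      have h3 : (2 * α) ^ 2 * (α * (-δ) ^ 2 + δ * (2 * α) * (-δ) + γ * (2 * α) ^ 2) =
        (4 * α ^ 3) * (4 * α * γ - δ ^ 2) := by ring
      rw [h3] at this
      exact nonneg_of_mul_nonneg_right this h2
    have h4 : (0 : ℤ) < 4 * α ^ 2 := by positivity
    have ident : ∀ x y : ℤ, 4 * α ^ 2 * (x * (α * y ^ 2 + δ * x * y + γ * x ^ 2)
      + (β * y ^ 2 + β2 * x * y + β3 * x ^ 2) + (l1 * y + l2 * x) + c) =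
      α * x * ((2 * α * y + δ * x) ^ 2 + (4 * α * γ - δ ^ 2) * x ^ 2)
        + ((β * δ ^ 2 - 2 * α * δ * β2 + 4 * α ^ 2 * β3) * x ^ 2
          + (-2 * β * δ + 2 * α * β2) * x * (2 * α * y + δ * x)
          + β * (2 * α * y + δ * x) ^ 2)
        + ((4 * α ^ 2 * l2 - 2 * α * l1 * δ) * x + (2 * α * l1) * (2 * α * y + δ * x))
        + 4 * α ^ 2 * c := by intro x y; ring
    rcases hΔ.eq_or_lt with hΔ | hΔ
    · have hq0 : β * δ ^ 2 - 2 * α * δ * β2 + 4 * α ^ 2 * β3 = 0 := by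
        have := aux_cubic_lead ((β * δ ^ 2 - 2 * α * δ * β2 + 4 * α ^ 2 * β3) * (2 * α) ^ 3)
          ((4 * α ^ 2 * l2 - 2 * α * l1 * δ) * (2 * α) ^ 2) (4 * α ^ 2 * c * (2 * α))
          (4 * α ^ 2 * D) (fun t => by
            have h5 := mul_le_mul_of_nonneg_left (hlow (2 * α * t) (-δ * t)) h4.le
            rw [mul_left_comm, ident, ← hΔ] at h5
            refine h5.trans (le_of_eq ?_)
            ring)
        rcases mul_eq_zero.1 this with h | h
        · exact h
        · exfalso; have : (0 : ℤ) < (2 * α) ^ 3 := by positivity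
          omega
      obtain ⟨X, hX⟩ := aux_large_deg α (-2 * β * δ + 2 * α * β2) β
        (4 * α ^ 2 * l2 - 2 * α * l1 * δ) (2 * α * l1) (4 * α ^ 2 * c) (4 * α ^ 2 * C) hα
      refine ⟨X, fun x y hx hG => ?_⟩
      have ident2 : ∀ x y : ℤ, 4 * α ^ 2 * (x * (α * y ^ 2 + δ * x * y + γ * x ^ 2)
        + (β * y ^ 2 + β2 * x * y + β3 * x ^ 2) + (l1 * y + l2 * x) + c) =
        x * (α * (2 * α * y + δ * x) ^ 2 + (-2 * β * δ + 2 * α * β2) * (2 * α * y + δ * x)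
          + (4 * α ^ 2 * l2 - 2 * α * l1 * δ)) +
        (β * (2 * α * y + δ * x) ^ 2 + (2 * α * l1) * (2 * α * y + δ * x) + 4 * α ^ 2 * c) := by
        intro x y
        rw [ident, ← hΔ, hq0]; ring
      have hid := ident2 x y
      by_cases hR : α * (2 * α * y + δ * x) ^ 2 + (-2 * β * δ + 2 * α * β2) * (2 * α * y + δ * x)
          + (4 * α ^ 2 * l2 - 2 * α * l1 * δ) = 0
      · exfalso
        set m := β * (2 * α * y + δ * x) ^ 2 + (2 * α * l1) * (2 * α * y + δ * x)
          + 4 * α ^ 2 * c with hm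
        have hm0 : m ≠ 0 := by
          intro hm0
          rw [hR, hm0] at hid
          simp only [mul_zero, add_zero] at hid
          rcases mul_eq_zero.1 hid with h | h
          · omega
          · exact hG h
        have := aux_lin_lead (m * (2 * α)) (m * x) (4 * α ^ 2 * D) (fun t => by
          have h5 := mul_le_mul_of_nonneg_left (hlow (x + 2 * α * t) (y - δ * t)) h4.le
          rw [mul_left_comm, ident2,
            show 2 * α * (y - δ * t) + δ * (x + 2 * α * t) = 2 * α * y + δ * x by ring,
            hR, ← hm] at h5
          linarith)
        rcases mul_eq_zero.1 this with h | h
        · exact hm0 h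
        · omega
      · have := hX x _ hx hR
        rw [← hid, abs_mul, abs_of_pos h4] at this
        exact lt_of_mul_lt_mul_left this h4.le
    · obtain ⟨X, hX⟩ := aux_large_pos α (4 * α * γ - δ ^ 2)
        (β * δ ^ 2 - 2 * α * δ * β2 + 4 * α ^ 2 * β3) (-2 * β * δ + 2 * α * β2) β
        (4 * α ^ 2 * l2 - 2 * α * l1 * δ) (2 * α * l1) (4 * α ^ 2 * c) (4 * α ^ 2 * C) hα hΔ
      refine ⟨X, fun x y hx _ => ?_⟩
      have := hX x (2 * α * y + δ * x) hx
      rw [← ident, abs_mul, abs_of_pos h4] at this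
      exact lt_of_mul_lt_mul_left this h4.le

/-- The rational-line case. -/
lemma aux_core_lin (κ α δ γ β β2 β3 l1 l2 c C D : ℤ) (hC : 0 < C)
    (hpos : ∀ x y : ℤ, 0 ≤ κ * x * y ^ 3 + α * x ^ 2 * y ^ 2 + δ * x ^ 3 * y + γ * x ^ 4)
    (hne : ¬ (κ = 0 ∧ α = 0 ∧ δ = 0 ∧ γ = 0))
    (f : ℤ → ℤ → ℤ)
    (hf : ∀ x y, f x y = (κ * x * y ^ 3 + α * x ^ 2 * y ^ 2 + δ * x ^ 3 * y + γ * x ^ 4)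
      + (β * x * y ^ 2 + β2 * x ^ 2 * y + β3 * x ^ 3) + (l1 * x * y + l2 * x ^ 2) + c * x)
    (hlow : ∀ x y : ℤ, D ≤ f x y)
    (hsurj : ∀ n : ℤ, D ≤ C * n → ∃ x y, f x y = C * n) : False := by
  have hκ : κ = 0 := aux_cubic_lead κ α δ (-γ) (fun t => by have := hpos 1 t; linarith)
  subst hκ
  have hf' : ∀ x y, f x y = x * (x * (α * y ^ 2 + δ * x * y + γ * x ^ 2)
      + (β * y ^ 2 + β2 * x * y + β3 * x ^ 2) + (l1 * y + l2 * x) + c) := by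
    intro x y; rw [hf]; ring
  obtain ⟨X, hX⟩ := aux_large α δ γ β β2 β3 l1 l2 c C D
    (fun x y => (hpos x y).trans (le_of_eq (by ring)))
    (fun h => hne ⟨rfl, h⟩) (fun x y => by rw [← hf']; exact hlow x y)
  have hq : ∀ x y, f x y = (α * x ^ 2 + β * x) * y ^ 2 + (δ * x ^ 3 + β2 * x ^ 2 + l1 * x) * y
      + (γ * x ^ 4 + β3 * x ^ 3 + l2 * x ^ 2 + c * x) := by
    intro x y; rw [hf]; ring
  obtain ⟨p, hp, hpN, hpe⟩ := aux_prime_escape (fun x => α * x ^ 2 + β * x)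
    (fun x => δ * x ^ 3 + β2 * x ^ 2 + l1 * x)
    (fun x => γ * x ^ 4 + β3 * x ^ 3 + l2 * x ^ 2 + c * x) (Finset.Icc (-C) C) C D hC
    (fun x _ t => by rw [← hq]; exact hlow x t) (X.toNat + D.toNat + 1)
  have hpX : X ≤ p := by omega
  have hpD : D ≤ p := by omega
  have hpp : Prime (p : ℤ) := Nat.prime_iff_prime_int.1 hp
  have hp0 : (0 : ℤ) < p := by exact_mod_cast hp.pos
  obtain ⟨x, y, hxy⟩ := hsurj p (by nlinarith)
  have hxy' := hxy
  rw [hf'] at hxy'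
  set G := x * (α * y ^ 2 + δ * x * y + γ * x ^ 2)
      + (β * y ^ 2 + β2 * x * y + β3 * x ^ 2) + (l1 * y + l2 * x) + c with hG
  have hG0 : G ≠ 0 := by
    intro h; rw [h, mul_zero] at hxy'
    have := mul_pos hC hp0
    omega
  by_cases hpx : (p : ℤ) ∣ x
  · obtain ⟨z, hz⟩ := hpx
    have hz0 : z ≠ 0 := by
      rintro rfl
      rw [hz] at hxy'
      have := mul_pos hC hp0
      simp at hxy'
      omega
    have h1 : z * G = C := by
      have : (p : ℤ) * (z * G) = p * C := by rw [hz] at hxy'; linarith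
      exact mul_left_cancel₀ hp0.ne' this
    have hz1 : 1 ≤ |z| := Int.one_le_abs hz0
    have hxl : X ≤ |x| := by
      rw [hz, abs_mul, abs_of_pos hp0]; nlinarith
    have h2 := hX x y hxl hG0
    have h3 : |z| * |G| = C := by rw [← abs_mul, h1, abs_of_pos hC]
    nlinarith [abs_nonneg G]
  · have hcop : IsCoprime x (p : ℤ) := ((hpp.coprime_iff_not_dvd).2 hpx).symm
    have hxC : x ∣ C := hcop.dvd_of_dvd_mul_right ⟨G, hxy'.symm⟩
    have hxa : |x| ≤ C := by
      have := Int.le_of_dvd hC ((abs_dvd x C).2 hxC)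
      exact this
    have := abs_le.1 hxa
    refine hpe x (by simp [this.1, this.2]) y ?_
    show _ = _
    rw [← hxy, hq]

lemma aux_not_all_squares (a b n0 : ℤ) (ha : 0 < a)
    (h : ∀ n : ℤ, n0 ≤ n → ∃ s : ℤ, a * n + b = s ^ 2) : False := by
  obtain ⟨n, hn⟩ : ∃ n : ℤ, n = |n0| + |b| + a ^ 2 + 1 := ⟨_, rfl⟩
  have h0 := le_abs_self n0
  have h0' := abs_nonneg n0
  have h1 := neg_abs_le b
  have h1' := abs_nonneg b
  have hn0 : n0 ≤ n := by nlinarith [sq_nonneg a]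
  obtain ⟨s, hs⟩ := h n hn0
  obtain ⟨t, ht⟩ := h (n + 1) (by linarith)
  have hn1 : n ≤ a * n := by nlinarith [sq_nonneg a]
  have big : a ^ 2 < s ^ 2 := by linarith
  have hst : t ^ 2 = s ^ 2 + a := by linarith
  rw [← sq_abs s] at big hst
  rw [← sq_abs t] at hst
  have hs0 := abs_nonneg s
  have ht0 := abs_nonneg t
  have h3 : a < |s| := lt_of_pow_lt_pow_left₀ 2 hs0 big
  have h4 : |s| < |t| := lt_of_pow_lt_pow_left₀ 2 ht0 (by linarith)
  nlinarith

lemma aux_rat_finite (X Y : ℝ) : {r : ℚ | |(r.num : ℝ)| ≤ X ∧ (r.den : ℝ) ≤ Y}.Finite := by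
  apply Set.Finite.subset (s := (fun r : ℚ => (r.num, r.den)) ⁻¹'
    ((Set.Icc (-⌈X⌉) ⌈X⌉) ×ˢ (Set.Iic ⌈Y⌉₊)))
  · apply Set.Finite.preimage
    · rintro r _ s _ hrs
      simp only [Prod.mk.injEq] at hrs
      exact Rat.ext hrs.1 hrs.2
    · exact (Set.finite_Icc _ _).prod (Set.finite_Iic _)
  · rintro r ⟨h1, h2⟩
    have h3 := abs_le.1 h1
    have h4 := Int.le_ceil X
    simp only [Set.mem_preimage, Set.mem_prod, Set.mem_Icc, Set.mem_Iic]
    refine ⟨⟨?_, ?_⟩, ?_⟩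
    · have : (-(⌈X⌉ : ℝ)) ≤ r.num := by linarith
      exact_mod_cast this
    · have : (r.num : ℝ) ≤ ⌈X⌉ := by linarith
      exact_mod_cast this
    · have : (r.den : ℝ) ≤ ⌈Y⌉₊ := h2.trans (Nat.le_ceil Y)
      exact_mod_cast this

lemma aux_irr_lin (θ : ℝ) (hθ : Irrational θ) (a b : ℚ) (h : (a : ℝ) * θ + b = 0) :
    a = 0 ∧ b = 0 := by
  by_cases ha : a = 0
  · subst ha
    simp at h
    exact ⟨rfl, h⟩
  · exfalso
    apply hθ
    refine ⟨-b / a, ?_⟩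
    have : (a : ℝ) ≠ 0 := by exact_mod_cast ha
    push_cast
    field_simp
    linarith

lemma aux_rat_mul_den (r : ℚ) (N : ℤ) (h : (r.den : ℤ) ∣ N) : ∃ z : ℤ, (N : ℚ) * r = z := by
  obtain ⟨k, rfl⟩ := h
  refine ⟨k * r.num, ?_⟩
  push_cast
  rw [mul_comm (r.den : ℚ), mul_assoc, Rat.den_mul_eq_num]

/-- The irrational-line case. -/
lemma aux_core_quad (θ : ℝ) (hirr : Irrational θ) (p q c l1 l0 e : ℚ)
    (hθ : θ ^ 2 + p * θ + q = 0) (hc : 0 < c) (C D : ℤ) (hC : 0 < C) (f : ℤ → ℤ → ℤ)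
    (hf : ∀ x y : ℤ, (f x y : ℚ) = c * (x ^ 2 + p * x * y + q * y ^ 2) ^ 2
      + (l1 * x + l0 * y) * (x ^ 2 + p * x * y + q * y ^ 2)
      + e * (x ^ 2 + p * x * y + q * y ^ 2))
    (hlow : ∀ x y : ℤ, D ≤ f x y)
    (hsurj : ∀ n : ℤ, D ≤ C * n → ∃ x y, f x y = C * n) : False := by
  obtain ⟨N, hN⟩ : ∃ N : ℤ, N = p.den * q.den := ⟨_, rfl⟩
  have hN0 : 0 < N := by rw [hN]; have := p.den_pos; have := q.den_pos; positivity
  obtain ⟨p', hp'⟩ := aux_rat_mul_den p N ⟨_, hN⟩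
  obtain ⟨q', hq'⟩ := aux_rat_mul_den q N ⟨p.den, by rw [hN]; ring⟩
  have hNM : ∀ x y : ℤ, (N : ℚ) * (x ^ 2 + p * x * y + q * y ^ 2)
      = ((N * x ^ 2 + p' * x * y + q' * y ^ 2 : ℤ) : ℚ) := by
    intro x y
    push_cast
    rw [← hp', ← hq']; ring
  have hl : l1 = 0 ∧ l0 = 0 := by
    by_contra hl
    set η := |(l1 : ℝ) * θ + l0| with hη
    have hη0 : 0 < η := abs_pos.2 (fun h => hl (aux_irr_lin θ hirr l1 l0 h))
    obtain ⟨K, hK⟩ : ∃ K : ℝ, K = 1 + |2 * θ + p| := ⟨_, rfl⟩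
    have hK0 : 0 ≤ K := by rw [hK]; positivity
    obtain ⟨K2, hK2⟩ : ∃ K2 : ℝ, K2 = c * K ^ 2 + |(e : ℝ)| * K + |(D : ℝ)| := ⟨_, rfl⟩
    obtain ⟨Y, hY⟩ : ∃ Y : ℝ, Y = (K2 * N + |(l1 : ℝ)|) / η := ⟨_, rfl⟩
    apply Real.infinite_rat_abs_sub_lt_one_div_den_sq_of_irrational hirr
    refine (aux_rat_finite (1 + |θ| * Y) Y).subset ?_
    intro r hr
    simp only [Set.mem_ofPred_eq] at hr ⊢
    obtain ⟨x, hx⟩ : ∃ x : ℤ, x = r.num := ⟨_, rfl⟩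
    obtain ⟨y, hy⟩ : ∃ y : ℤ, y = r.den := ⟨_, rfl⟩
    have hyR : (r.den : ℝ) = y := by rw [hy]; push_cast; rfl
    have hrR : (r : ℝ) = x / y := by
      rw [← hyR, hx]; exact_mod_cast (Rat.num_div_den r).symm
    have hy1 : (1 : ℝ) ≤ y := by rw [← hyR]; exact_mod_cast r.den_pos
    rw [← hx, hyR]
    rw [hyR, hrR] at hr
    have hy0 : (0 : ℝ) < y := by linarith
    obtain ⟨ε, hε⟩ : ∃ ε : ℝ, ε = x - θ * y := ⟨_, rfl⟩
    have hεy : |ε| * y ≤ 1 := by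
      have h1 : |θ - x / y| * y ^ 2 ≤ 1 := by
        rw [lt_div_iff₀ (by positivity)] at hr; exact hr.le
      have h2 : |ε| = |θ - x / y| * y := by
        rw [hε, ← abs_of_pos hy0, ← abs_mul, abs_of_pos hy0, abs_sub_comm]
        congr 1
        field_simp
      rw [h2]; linarith
    have hε1 : |ε| ≤ 1 := by nlinarith [abs_nonneg ε]
    obtain ⟨m, hm⟩ : ∃ m : ℝ, m = x ^ 2 + p * x * y + q * y ^ 2 := ⟨_, rfl⟩
    have hm2 : m = ε * (ε + (2 * θ + p) * y) := by
      rw [hm, hε]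
      have : (q : ℝ) = - θ ^ 2 - p * θ := by linarith
      rw [this]; ring
    have hmK : |m| ≤ K := by
      rw [hm2, abs_mul, hK]
      have h1 : |ε + (2 * θ + p) * y| ≤ |ε| + |2 * θ + p| * y := by
        refine (abs_add_le _ _).trans ?_
        rw [abs_mul, abs_of_pos hy0]
      calc |ε| * |ε + (2 * θ + p) * y| ≤ |ε| * (|ε| + |2 * θ + p| * y) := by gcongr
        _ = |ε| * |ε| + |2 * θ + p| * (|ε| * y) := by ring
        _ ≤ 1 * 1 + |2 * θ + p| * 1 := by gcongr
        _ = _ := by ring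
    have hm0 : m ≠ 0 := by
      intro h
      rw [hm2] at h
      have hyQ : (y : ℚ) ≠ 0 := by exact_mod_cast hy0.ne'
      rcases mul_eq_zero.1 h with h | h
      · have := aux_irr_lin θ hirr (-y) x (by push_cast; linarith)
        exact hyQ (by linarith [this.1])
      · have := aux_irr_lin θ hirr y (x + p * y) (by push_cast; rw [hε] at h; linarith)
        exact hyQ this.1
    have hNMR : (N : ℝ) * m = ((N * x ^ 2 + p' * x * y + q' * y ^ 2 : ℤ) : ℝ) := by
      rw [hm]; exact_mod_cast hNM x y
    have hNR : (0 : ℝ) < N := by exact_mod_cast hN0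
    have hmN : 1 ≤ N * |m| := by
      rw [← abs_of_pos hNR, ← abs_mul, hNMR]
      have : (N * x ^ 2 + p' * x * y + q' * y ^ 2 : ℤ) ≠ 0 := by
        intro h
        rw [h] at hNMR
        simp only [Int.cast_zero, mul_eq_zero] at hNMR
        rcases hNMR with h | h
        · exact hNR.ne' h
        · exact hm0 h
      exact_mod_cast Int.one_le_abs this
    obtain ⟨L, hL⟩ : ∃ L : ℝ, L = l1 * x + l0 * y := ⟨_, rfl⟩
    have f1 : (f x y : ℝ) = c * m ^ 2 + L * m + e * m := by
      rw [hm, hL]; exact_mod_cast hf x y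
    have f2 : (f (-x) (-y) : ℝ) = c * m ^ 2 - L * m + e * m := by
      have := hf (-x) (-y)
      have h2 : (f (-x) (-y) : ℝ) = c * ((-x) ^ 2 + p * (-x) * (-y) + q * (-y) ^ 2) ^ 2
      + (l1 * (-x) + l0 * (-y)) * ((-x) ^ 2 + p * (-x) * (-y) + q * (-y) ^ 2)
      + e * ((-x) ^ 2 + p * (-x) * (-y) + q * (-y) ^ 2) := by exact_mod_cast this
      rw [h2, hm, hL]; ring
    have d1 : (D : ℝ) ≤ f x y := by exact_mod_cast hlow x y
    have d2 : (D : ℝ) ≤ f (-x) (-y) := by exact_mod_cast hlow (-x) (-y)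
    have hcR : (0 : ℝ) < c := by exact_mod_cast hc
    have hLm : |L * m| ≤ K2 := by
      have g1 : c * m ^ 2 ≤ c * K ^ 2 := by
        rw [← sq_abs m]; gcongr
      have g2 : e * m ≤ |(e : ℝ)| * K := by
        refine (le_abs_self _).trans ?_
        rw [abs_mul]; gcongr
      have g3 := neg_abs_le (D : ℝ)
      rw [abs_le]
      constructor <;> linarith
    have hLN : |L| ≤ K2 * N := by
      calc |L| = |L| * 1 := by ring
        _ ≤ |L| * (N * |m|) := by gcongr
        _ = |L * m| * N := by rw [abs_mul]; ring
        _ ≤ K2 * N := by gcongr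
    have hyY : (y : ℝ) ≤ Y := by
      rw [hY, le_div_iff₀ hη0]
      have h1 : ((l1 : ℝ) * θ + l0) * y = L - l1 * ε := by rw [hL, hε]; ring
      have h2 : y * η = |((l1 : ℝ) * θ + l0) * y| := by
        rw [abs_mul, abs_of_pos hy0, mul_comm]
      rw [h2, h1]
      refine (abs_sub _ _).trans ?_
      rw [abs_mul]
      have : |(l1 : ℝ)| * |ε| ≤ |(l1 : ℝ)| * 1 := by gcongr
      linarith
    refine ⟨?_, hyY⟩
    have : (x : ℝ) = ε + θ * y := by rw [hε]; ring
    rw [this]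
    refine (abs_add_le _ _).trans ?_
    rw [abs_mul, abs_of_pos hy0]
    gcongr
  obtain ⟨rfl, rfl⟩ := hl
  obtain ⟨W, hW⟩ : ∃ W : ℤ, W = c.den * e.den := ⟨_, rfl⟩
  have hW0 : 0 < W := by rw [hW]; have := c.den_pos; have := e.den_pos; positivity
  obtain ⟨c', hc'⟩ := aux_rat_mul_den c W ⟨_, hW⟩
  obtain ⟨e', he'⟩ := aux_rat_mul_den e W ⟨c.den, by rw [hW]; ring⟩
  have hc0 : 0 < c' := by
    have : (0 : ℚ) < c' := by rw [← hc']; have : (0 : ℚ) < W := by exact_mod_cast hW0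
                              positivity
    exact_mod_cast this
  have hfin : ∀ x y : ℤ, W * N ^ 2 * f x y = c' * (N * x ^ 2 + p' * x * y + q' * y ^ 2) ^ 2
      + e' * N * (N * x ^ 2 + p' * x * y + q' * y ^ 2) := by
    intro x y
    have : ((W * N ^ 2 * f x y : ℤ) : ℚ) = ((c' * (N * x ^ 2 + p' * x * y + q' * y ^ 2) ^ 2
      + e' * N * (N * x ^ 2 + p' * x * y + q' * y ^ 2) : ℤ) : ℚ) := by
      have h1 := hNM x y
      push_cast at h1 ⊢
      rw [hf, ← h1, ← hc', ← he']
      ring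
    exact_mod_cast this
  refine aux_not_all_squares (4 * c' * W * N ^ 2 * C) ((e' * N) ^ 2) |D| (by positivity)
    (fun n hn => ?_)
  have hDn : D ≤ C * n := by
    have := le_abs_self D
    have := abs_nonneg D
    nlinarith
  obtain ⟨x, y, hxy⟩ := hsurj n hDn
  refine ⟨2 * c' * (N * x ^ 2 + p' * x * y + q' * y ^ 2) + e' * N, ?_⟩
  have := hfin x y
  rw [hxy] at this
  linear_combination 4 * c' * this

lemma aux_quad_of_irr (θ : ℝ) (hirr : Irrational θ) (A0 A1 A2 A3 A4 : ℚ)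
    (hne : ¬ (A0 = 0 ∧ A1 = 0 ∧ A2 = 0 ∧ A3 = 0 ∧ A4 = 0))
    (h : A4 * θ ^ 4 + A3 * θ ^ 3 + A2 * θ ^ 2 + A1 * θ + A0 = 0)
    (h' : 4 * A4 * θ ^ 3 + 3 * A3 * θ ^ 2 + 2 * A2 * θ + A1 = 0) :
    ∃ p q : ℚ, θ ^ 2 + p * θ + q = 0 := by
  classical
  obtain ⟨P, hP⟩ : ∃ P : Polynomial ℚ, P = Polynomial.C A4 * Polynomial.X ^ 4
    + Polynomial.C A3 * Polynomial.X ^ 3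
    + Polynomial.C A2 * Polynomial.X ^ 2 + Polynomial.C A1 * Polynomial.X + Polynomial.C A0 :=
      ⟨_, rfl⟩
  have hP0 : P ≠ 0 := by
    intro h0
    apply hne
    rw [hP] at h0
    have c0 := congrArg (fun Q => Polynomial.coeff Q 0) h0
    have c1 := congrArg (fun Q => Polynomial.coeff Q 1) h0
    have c2 := congrArg (fun Q => Polynomial.coeff Q 2) h0
    have c3 := congrArg (fun Q => Polynomial.coeff Q 3) h0
    have c4 := congrArg (fun Q => Polynomial.coeff Q 4) h0
    simp [Polynomial.coeff_X, Polynomial.coeff_C, Polynomial.coeff_X_pow] at c0 c1 c2 c3 c4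
    exact ⟨c0, c1, c2, c3, c4⟩
  have hPdeg : P.natDegree ≤ 4 := by rw [hP]; compute_degree
  have e1 : Polynomial.aeval θ P = 0 := by
    rw [hP]; simpa using h
  have e2 : Polynomial.aeval θ (Polynomial.derivative P) = 0 := by
    rw [hP]
    simp
    linarith
  have hint : IsIntegral ℚ θ := isAlgebraic_iff_isIntegral.1 ⟨P, hP0, e1⟩
  obtain ⟨m, hm⟩ : ∃ m, m = minpoly ℚ θ := ⟨_, rfl⟩
  have hm0 : m ≠ 0 := hm ▸ minpoly.ne_zero hint
  have hmθ : Polynomial.aeval θ m = 0 := hm ▸ minpoly.aeval ℚ θ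
  obtain ⟨g, hg⟩ : m ∣ P := hm ▸ minpoly.dvd ℚ θ e1
  have hsep : m.Separable := hm ▸ (minpoly.irreducible hint).separable
  have hgθ : Polynomial.aeval θ g = 0 := by
    rw [hg, Polynomial.derivative_mul] at e2
    simp only [map_add, map_mul, hmθ, zero_mul, add_zero] at e2
    exact (mul_eq_zero.1 e2).resolve_left (hsep.aeval_derivative_ne_zero hmθ)
  obtain ⟨k, hk⟩ : m ∣ g := hm ▸ minpoly.dvd ℚ θ hgθ
  have hk0 : k ≠ 0 := by rintro rfl; apply hP0; rw [hg, hk]; simp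
  have hmdeg : m.natDegree < 3 := by
    rw [hg, hk, Polynomial.natDegree_mul hm0 (mul_ne_zero hm0 hk0),
      Polynomial.natDegree_mul hm0 hk0] at hPdeg
    omega
  have hev : (m.coeff 2 : ℝ) * θ ^ 2 + m.coeff 1 * θ + m.coeff 0 = 0 := by
    rw [Polynomial.aeval_eq_sum_range' hmdeg] at hmθ
    simp [Finset.sum_range_succ, Algebra.smul_def] at hmθ
    linarith
  by_cases h2 : m.coeff 2 = 0
  · exfalso
    rw [h2] at hev
    have := aux_irr_lin θ hirr (m.coeff 1) (m.coeff 0) (by simpa using hev)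
    apply hm0
    ext i
    by_cases hi : i < 3
    · interval_cases i <;> simp [this, h2]
    · rw [Polynomial.coeff_eq_zero_of_natDegree_lt (by omega)]; simp
  · refine ⟨m.coeff 1 / m.coeff 2, m.coeff 0 / m.coeff 2, ?_⟩
    have h2' : (m.coeff 2 : ℝ) ≠ 0 := by exact_mod_cast h2
    push_cast
    field_simp
    linarith

lemma aux_sub4 (A0 A1 A2 A3 A4 v a w b : ℤ)
    (h : A4 * a ^ 4 + A3 * a ^ 3 * b + A2 * a ^ 2 * b ^ 2 + A1 * a * b ^ 3 + A0 * b ^ 4 = 0) :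
    ∃ κ α δ γ : ℤ, ∀ x y X Y : ℤ, x = v * X + a * Y → y = w * X + b * Y →
      A4 * x ^ 4 + A3 * x ^ 3 * y + A2 * x ^ 2 * y ^ 2 + A1 * x * y ^ 3 + A0 * y ^ 4 =
      κ * X * Y ^ 3 + α * X ^ 2 * Y ^ 2 + δ * X ^ 3 * Y + γ * X ^ 4 := by
  refine ⟨(4 * A0 * w * b ^ 3 + 3 * A1 * a * w * b ^ 2 + A1 * v * b ^ 3 + 2 * A2 * a ^ 2 * w * b
      + 2 * A2 * v * a * b ^ 2 + A3 * a ^ 3 * w + 3 * A3 * v * a ^ 2 * b + 4 * A4 * v * a ^ 3),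
    (6 * A0 * w ^ 2 * b ^ 2 + 3 * A1 * a * w ^ 2 * b + 3 * A1 * v * w * b ^ 2
      + A2 * a ^ 2 * w ^ 2 + 4 * A2 * v * a * w * b + A2 * v ^ 2 * b ^ 2 + 3 * A3 * v * a ^ 2 * w
      + 3 * A3 * v ^ 2 * a * b + 6 * A4 * v ^ 2 * a ^ 2),
    (4 * A0 * w ^ 3 * b + A1 * a * w ^ 3 + 3 * A1 * v * w ^ 2 * b + 2 * A2 * v * a * w ^ 2
      + 2 * A2 * v ^ 2 * w * b + 3 * A3 * v ^ 2 * a * w + A3 * v ^ 3 * b + 4 * A4 * v ^ 3 * a),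
    (A0 * w ^ 4 + A1 * v * w ^ 3 + A2 * v ^ 2 * w ^ 2 + A3 * v ^ 3 * w + A4 * v ^ 4), ?_⟩
  rintro x y X Y rfl rfl
  linear_combination Y ^ 4 * h

lemma aux_sub3 (B0 B1 B2 B3 v a w b : ℤ)
    (h : B3 * a ^ 3 + B2 * a ^ 2 * b + B1 * a * b ^ 2 + B0 * b ^ 3 = 0) :
    ∃ β β2 β3 : ℤ, ∀ x y X Y : ℤ, x = v * X + a * Y → y = w * X + b * Y →
      B3 * x ^ 3 + B2 * x ^ 2 * y + B1 * x * y ^ 2 + B0 * y ^ 3 =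
      β * X * Y ^ 2 + β2 * X ^ 2 * Y + β3 * X ^ 3 := by
  refine ⟨(3 * B0 * w * b ^ 2 + 2 * B1 * a * w * b + B1 * v * b ^ 2 + B2 * a ^ 2 * w
      + 2 * B2 * v * a * b + 3 * B3 * v * a ^ 2),
    (3 * B0 * w ^ 2 * b + B1 * a * w ^ 2 + 2 * B1 * v * w * b + 2 * B2 * v * a * w
      + B2 * v ^ 2 * b + 3 * B3 * v ^ 2 * a),
    (B0 * w ^ 3 + B1 * v * w ^ 2 + B2 * v ^ 2 * w + B3 * v ^ 3), ?_⟩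
  rintro x y X Y rfl rfl
  linear_combination Y ^ 3 * h

lemma aux_sub2 (C0 C1 C2 v a w b : ℤ)
    (h : C2 * a ^ 2 + C1 * a * b + C0 * b ^ 2 = 0) :
    ∃ l1 l2 : ℤ, ∀ x y X Y : ℤ, x = v * X + a * Y → y = w * X + b * Y →
      C2 * x ^ 2 + C1 * x * y + C0 * y ^ 2 = l1 * X * Y + l2 * X ^ 2 := by
  refine ⟨(2 * C0 * w * b + C1 * a * w + C1 * v * b + 2 * C2 * v * a),
    (C0 * w ^ 2 + C1 * v * w + C2 * v ^ 2), ?_⟩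
  rintro x y X Y rfl rfl
  linear_combination Y ^ 2 * h

/-- Explicit version of the theorem once a common real zero is known. -/
lemma aux_final (A0 A1 A2 A3 A4 B0 B1 B2 B3 C0 C1 C2 D0 D1 C D : ℤ) (hC : 0 < C)
    (hpos : ∀ x y : ℝ, 0 ≤ A4 * x ^ 4 + A3 * x ^ 3 * y + A2 * x ^ 2 * y ^ 2
      + A1 * x * y ^ 3 + A0 * y ^ 4)
    (hne : ¬ (A0 = 0 ∧ A1 = 0 ∧ A2 = 0 ∧ A3 = 0 ∧ A4 = 0))
    (s t : ℝ) (hst : ¬ (s = 0 ∧ t = 0))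
    (z4 : A4 * s ^ 4 + A3 * s ^ 3 * t + A2 * s ^ 2 * t ^ 2 + A1 * s * t ^ 3 + A0 * t ^ 4 = 0)
    (z3 : B3 * s ^ 3 + B2 * s ^ 2 * t + B1 * s * t ^ 2 + B0 * t ^ 3 = 0)
    (z2 : C2 * s ^ 2 + C1 * s * t + C0 * t ^ 2 = 0)
    (z1 : D1 * s + D0 * t = 0)
    (f : ℤ → ℤ → ℤ)
    (hf : ∀ x y, f x y =
      (A4 * x ^ 4 + A3 * x ^ 3 * y + A2 * x ^ 2 * y ^ 2 + A1 * x * y ^ 3 + A0 * y ^ 4)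
      + (B3 * x ^ 3 + B2 * x ^ 2 * y + B1 * x * y ^ 2 + B0 * y ^ 3)
      + (C2 * x ^ 2 + C1 * x * y + C0 * y ^ 2) + (D1 * x + D0 * y))
    (hlow : ∀ x y : ℤ, D ≤ f x y)
    (hsurj : ∀ n : ℤ, D ≤ C * n → ∃ x y, f x y = C * n) : False := by
  by_cases hrat : ∃ (μ : ℝ) (a b : ℤ), μ ≠ 0 ∧ IsCoprime a b ∧ s = μ * a ∧ t = μ * b
  · obtain ⟨μ, a, b, hμ, ⟨u, v, huv⟩, rfl, rfl⟩ := hrat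
    have y4 : A4 * a ^ 4 + A3 * a ^ 3 * b + A2 * a ^ 2 * b ^ 2 + A1 * a * b ^ 3 + A0 * b ^ 4 = 0 := by
      have : μ ^ 4 * ((A4 * a ^ 4 + A3 * a ^ 3 * b + A2 * a ^ 2 * b ^ 2 + A1 * a * b ^ 3
        + A0 * b ^ 4 : ℤ) : ℝ) = 0 := by push_cast; linarith
      exact_mod_cast (mul_eq_zero.1 this).resolve_left (pow_ne_zero _ hμ)
    have y3 : B3 * a ^ 3 + B2 * a ^ 2 * b + B1 * a * b ^ 2 + B0 * b ^ 3 = 0 := by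
      have : μ ^ 3 * ((B3 * a ^ 3 + B2 * a ^ 2 * b + B1 * a * b ^ 2 + B0 * b ^ 3 : ℤ) : ℝ) = 0 := by
        push_cast; linarith
      exact_mod_cast (mul_eq_zero.1 this).resolve_left (pow_ne_zero _ hμ)
    have y2 : C2 * a ^ 2 + C1 * a * b + C0 * b ^ 2 = 0 := by
      have : μ ^ 2 * ((C2 * a ^ 2 + C1 * a * b + C0 * b ^ 2 : ℤ) : ℝ) = 0 := by
        push_cast; linarith
      exact_mod_cast (mul_eq_zero.1 this).resolve_left (pow_ne_zero _ hμ)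
    have y1 : D1 * a + D0 * b = 0 := by
      have : μ * ((D1 * a + D0 * b : ℤ) : ℝ) = 0 := by
        push_cast; linarith
      exact_mod_cast (mul_eq_zero.1 this).resolve_left hμ
    obtain ⟨κ, α, δ, γ, h4⟩ := aux_sub4 A0 A1 A2 A3 A4 v a (-u) b y4
    obtain ⟨β, β2, β3, h3⟩ := aux_sub3 B0 B1 B2 B3 v a (-u) b y3
    obtain ⟨l1, l2, h2⟩ := aux_sub2 C0 C1 C2 v a (-u) b y2
    refine aux_core_lin κ α δ γ β β2 β3 l1 l2 (D1 * v + D0 * (-u)) C D hC ?_ ?_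
      (fun X Y => f (v * X + a * Y) (-u * X + b * Y)) ?_ (fun X Y => hlow _ _) ?_
    · intro X Y
      rw [← h4 _ _ X Y rfl rfl]
      exact_mod_cast hpos (v * X + a * Y : ℤ) (-u * X + b * Y : ℤ)
    · rintro ⟨rfl, rfl, rfl, rfl⟩
      have hz : ∀ x y : ℤ, A4 * x ^ 4 + A3 * x ^ 3 * y + A2 * x ^ 2 * y ^ 2 + A1 * x * y ^ 3
          + A0 * y ^ 4 = 0 := by
        intro x y
        rw [h4 x y (b * x - a * y) (u * x + v * y) (by linear_combination -x * huv)
          (by linear_combination -y * huv)]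
        ring
      have k1 := hz 1 0
      have k2 := hz 0 1
      have k3 := hz 1 1
      have k4 := hz 1 (-1)
      have k5 := hz 2 1
      norm_num at k1 k2 k3 k4 k5
      apply hne
      refine ⟨?_, ?_, ?_, ?_, ?_⟩ <;> linarith
    · intro X Y
      show f _ _ = _
      rw [hf, h4 _ _ X Y rfl rfl, h3 _ _ X Y rfl rfl, h2 _ _ X Y rfl rfl]
      linear_combination Y * y1
    · intro n hn
      obtain ⟨x, y, hxy⟩ := hsurj n hn
      refine ⟨b * x - a * y, u * x + v * y, ?_⟩
      show f _ _ = _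
      rw [← hxy]
      congr 1
      · linear_combination x * huv
      · linear_combination y * huv
  · have ht : t ≠ 0 := by
      rintro rfl
      have hs : s ≠ 0 := fun h => hst ⟨h, rfl⟩
      exact hrat ⟨s, 1, 0, hs, isCoprime_one_left, by simp, by simp⟩
    obtain ⟨θ, hθ⟩ : ∃ θ, θ = s / t := ⟨_, rfl⟩
    have hs : s = θ * t := by rw [hθ]; field_simp
    have hirr : Irrational θ := by
      rintro ⟨r, hr⟩
      have hd : (r.den : ℝ) ≠ 0 := by exact_mod_cast r.den_nz
      refine hrat ⟨t / r.den, r.num, r.den, div_ne_zero ht hd, ?_, ?_, ?_⟩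
      · exact Int.isCoprime_iff_gcd_eq_one.2 r.reduced
      · rw [hs, ← hr]
        nth_rewrite 1 [← Rat.num_div_den r]
        push_cast
        field_simp
      · push_cast
        field_simp
    subst hs
    have w4 : A4 * θ ^ 4 + A3 * θ ^ 3 + A2 * θ ^ 2 + A1 * θ + A0 = 0 := by
      have : t ^ 4 * (A4 * θ ^ 4 + A3 * θ ^ 3 + A2 * θ ^ 2 + A1 * θ + A0) = 0 := by linarith
      exact (mul_eq_zero.1 this).resolve_left (pow_ne_zero _ ht)
    have w3 : B3 * θ ^ 3 + B2 * θ ^ 2 + B1 * θ + B0 = 0 := by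
      have : t ^ 3 * (B3 * θ ^ 3 + B2 * θ ^ 2 + B1 * θ + B0) = 0 := by linarith
      exact (mul_eq_zero.1 this).resolve_left (pow_ne_zero _ ht)
    have w2 : C2 * θ ^ 2 + C1 * θ + C0 = 0 := by
      have : t ^ 2 * (C2 * θ ^ 2 + C1 * θ + C0) = 0 := by linarith
      exact (mul_eq_zero.1 this).resolve_left (pow_ne_zero _ ht)
    have w1 : D1 * θ + D0 = 0 := by
      have : t * (D1 * θ + D0) = 0 := by linarith
      exact (mul_eq_zero.1 this).resolve_left ht
    have w4' : 4 * A4 * θ ^ 3 + 3 * A3 * θ ^ 2 + 2 * A2 * θ + A1 = 0 := by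
      have hd : HasDerivAt (fun x : ℝ => A4 * x ^ 4 + A3 * x ^ 3 + A2 * x ^ 2 + A1 * x + A0)
          (4 * A4 * θ ^ 3 + 3 * A3 * θ ^ 2 + 2 * A2 * θ + A1) θ := by
        have := (((((hasDerivAt_pow 4 θ).const_mul (A4 : ℝ)).add
          ((hasDerivAt_pow 3 θ).const_mul (A3 : ℝ))).add
          ((hasDerivAt_pow 2 θ).const_mul (A2 : ℝ))).add
          ((hasDerivAt_id θ).const_mul (A1 : ℝ))).add_const (A0 : ℝ)
        convert! this using 1
        norm_num
        ring
      refine IsLocalMin.hasDerivAt_eq_zero (Filter.Eventually.of_forall (fun x => ?_)) hd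
      show _ ≤ _
      rw [w4]
      have := hpos x 1
      linarith
    obtain ⟨p, q, hpq⟩ := aux_quad_of_irr θ hirr A0 A1 A2 A3 A4 (by exact_mod_cast hne)
      (by exact_mod_cast w4) (by exact_mod_cast w4')
    -- the quartic
    have hd0 : 2 * θ + p ≠ 0 := by
      intro h
      have := aux_irr_lin θ hirr 2 p (by exact_mod_cast h)
      norm_num at this
    obtain ⟨g1, hg1⟩ : ∃ g1 : ℚ, g1 = A3 - p * A4 := ⟨_, rfl⟩
    obtain ⟨g0, hg0⟩ : ∃ g0 : ℚ, g0 = A2 - p * g1 - q * A4 := ⟨_, rfl⟩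
    have hg1R : (g1 : ℝ) = A3 - p * A4 := by rw [hg1]; push_cast; ring
    have hg0R : (g0 : ℝ) = A2 - p * g1 - q * A4 := by rw [hg0]; push_cast; ring
    have r4 := aux_irr_lin θ hirr (A1 - p * g0 - q * g1) (A0 - q * g0) (by
      push_cast
      rw [hg0R, hg1R]
      linear_combination w4 - (A4 * θ ^ 2 + (A3 - p * A4) * θ
        + (A2 - p * (A3 - p * A4) - q * A4)) * hpq)
    have r4aR : (A1 : ℝ) - p * g0 - q * g1 = 0 := by exact_mod_cast r4.1
    have hgθ : A4 * θ ^ 2 + g1 * θ + g0 = 0 := by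
      have : (2 * θ + p) * (A4 * θ ^ 2 + g1 * θ + g0) = 0 := by
        linear_combination w4' - (2 * A4 * θ + g1) * hpq + (3 * θ ^ 2) * hg1R
          + (2 * θ) * hg0R - r4aR
      exact (mul_eq_zero.1 this).resolve_left hd0
    have r4' := aux_irr_lin θ hirr (g1 - p * A4) (g0 - q * A4) (by
      push_cast
      linear_combination hgθ - A4 * hpq)
    obtain ⟨m0, hm0⟩ : ∃ m0 : ℚ, m0 = B2 - p * B3 := ⟨_, rfl⟩
    have r3 := aux_irr_lin θ hirr (B1 - p * m0 - q * B3) (B0 - q * m0) (by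
      rw [hm0]
      push_cast
      linear_combination w3 - (B3 * θ + (B2 - p * B3)) * hpq)
    have r2 := aux_irr_lin θ hirr (C1 - p * C2) (C0 - q * C2) (by
      push_cast
      linear_combination w2 - C2 * hpq)
    have r1 := aux_irr_lin θ hirr D1 D0 (by exact_mod_cast w1)
    have hA4 : (0 : ℚ) < A4 := by
      have h1 : 0 ≤ A4 := by
        have := hpos 1 0
        norm_num at this
        exact this
      have h2 : A4 ≠ 0 := by
        intro h
        have e1 : g1 = 0 := by have := r4'.1; rw [h] at this; simpa using this
        have e0 : g0 = 0 := by have := r4'.2; rw [h] at this; simpa using this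
        have e3 : A3 = 0 := by rw [h, e1] at hg1; have : (A3 : ℚ) = 0 := by simpa using hg1.symm
                               exact_mod_cast this
        have e2 : A2 = 0 := by rw [h, e1, e0] at hg0; have : (A2 : ℚ) = 0 := by simpa using hg0.symm
                               exact_mod_cast this
        have e11 : A1 = 0 := by have := r4.1; rw [e1, e0] at this; have : (A1 : ℚ) = 0 := by simpa using this
                                exact_mod_cast this
        have e00 : A0 = 0 := by have := r4.2; rw [e0] at this; have : (A0 : ℚ) = 0 := by simpa using this
                                exact_mod_cast this
        exact hne ⟨e00, e11, e2, e3, h⟩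
      exact_mod_cast lt_of_le_of_ne h1 (Ne.symm h2)
    refine aux_core_quad θ hirr p q A4 B3 m0 C2 hpq hA4 C D hC f ?_ hlow hsurj
    intro x y
    rw [hf]
    push_cast
    have t1 : g1 = p * A4 := by linarith [r4'.1]
    have t0 : g0 = q * A4 := by linarith [r4'.2]
    have a3 : (A3 : ℚ) = g1 + p * A4 := by linarith
    have a2 : (A2 : ℚ) = g0 + p * g1 + q * A4 := by linarith
    have a1 : (A1 : ℚ) = p * g0 + q * g1 := by linarith [r4.1]
    have a0 : (A0 : ℚ) = q * g0 := by linarith [r4.2]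
    have b2 : (B2 : ℚ) = m0 + p * B3 := by linarith
    have b1 : (B1 : ℚ) = p * m0 + q * B3 := by linarith [r3.1]
    have b0 : (B0 : ℚ) = q * m0 := by linarith [r3.2]
    have c1 : (C1 : ℚ) = p * C2 := by linarith [r2.1]
    have c0 : (C0 : ℚ) = q * C2 := by linarith [r2.2]
    rw [a3, a2, a1, a0, t1, t0, b2, b1, b0, c1, c0, r1.1, r1.2]
    ring

/-- The homogenizing substitution. -/
noncomputable def auxPhi (R : Type*) [CommRing R] :
    MvPolynomial (Fin 2) R →ₐ[R] Polynomial (MvPolynomial (Fin 2) R) :=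
  MvPolynomial.aeval (fun i => Polynomial.C (MvPolynomial.X i) * Polynomial.X)

lemma auxPhi_monomial (R : Type*) [CommRing R] (m : Fin 2 →₀ ℕ) (r : R) :
    auxPhi R (monomial m r) = Polynomial.C (monomial m r) * Polynomial.X ^ m.degree := by
  rw [auxPhi, aeval_monomial, monomial_eq, Finsupp.prod_fintype _ _ (by simp),
    Finsupp.prod_fintype _ _ (by simp), Finsupp.degree_eq_sum]
  simp only [mul_pow, Fin.prod_univ_two, Fin.sum_univ_two, map_mul, map_pow, pow_add]
  rw [IsScalarTower.algebraMap_apply R (MvPolynomial (Fin 2) R)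
    (Polynomial (MvPolynomial (Fin 2) R)), MvPolynomial.algebraMap_eq, Polynomial.algebraMap_eq]
  ring

lemma auxPhi_coeff (R : Type*) [CommRing R] (p : MvPolynomial (Fin 2) R) (k : ℕ) :
    (auxPhi R p).coeff k = homogeneousComponent k p := by
  induction p using MvPolynomial.induction_on' with
  | monomial m r =>
    rw [auxPhi_monomial, Polynomial.coeff_C_mul_X_pow]
    split_ifs with h
    · exact (homogeneousComponent_eq_self (isHomogeneous_monomial r h.symm)).symm
    · rw [homogeneousComponent_of_mem (isHomogeneous_monomial r rfl), if_neg h]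
  | add p q hp hq => rw [map_add, map_add, Polynomial.coeff_add, hp, hq]

lemma aux_hom_of_comp {R : Type*} [CommRing R] (p : MvPolynomial (Fin 2) R) (k : ℕ)
    (h : ∀ j, j ≠ k → homogeneousComponent j p = 0) : p.IsHomogeneous k := by
  rw [IsHomogeneous, IsWeightedHomogeneous]
  intro m hm
  by_contra hne
  have h1 := h m.degree (by rw [Finsupp.degree_eq_weight_one]; exact hne)
  have h2 := coeff_homogeneousComponent m.degree p m
  rw [h1] at h2
  simp at h2
  exact hm h2.symm

lemma aux_hom_of_mul {R : Type*} [CommRing R] [IsDomain R] (p q : MvPolynomial (Fin 2) R) (n : ℕ)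
    (h : (p * q).IsHomogeneous n) (h0 : p * q ≠ 0) : ∃ k, p.IsHomogeneous k := by
  have hphi : auxPhi R p * auxPhi R q = Polynomial.C (p * q) * Polynomial.X ^ n := by
    rw [← map_mul]
    ext1 k
    rw [auxPhi_coeff, Polynomial.coeff_C_mul_X_pow]
    split_ifs with hk
    · rw [hk]; exact homogeneousComponent_eq_self h
    · rw [homogeneousComponent_of_mem h, if_neg hk]
  have hne : auxPhi R p * auxPhi R q ≠ 0 := by
    rw [hphi]
    exact mul_ne_zero (by simpa using h0) (pow_ne_zero _ Polynomial.X_ne_zero)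
  have hp := left_ne_zero_of_mul hne
  have hq := right_ne_zero_of_mul hne
  have d1 : (auxPhi R p * auxPhi R q).natDegree = n := by
    rw [hphi]; exact Polynomial.natDegree_C_mul_X_pow n _ h0
  have d2 : (auxPhi R p * auxPhi R q).natTrailingDegree = n := by
    rw [hphi, Polynomial.C_mul_X_pow_eq_monomial]
    exact Polynomial.natTrailingDegree_monomial h0
  rw [Polynomial.natDegree_mul hp hq] at d1
  rw [Polynomial.natTrailingDegree_mul hp hq] at d2
  have i1 := Polynomial.natTrailingDegree_le_natDegree (auxPhi R p)
  have i2 := Polynomial.natTrailingDegree_le_natDegree (auxPhi R q)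
  refine ⟨(auxPhi R p).natDegree, aux_hom_of_comp p _ (fun j hj => ?_)⟩
  rw [← auxPhi_coeff]
  rcases lt_or_gt_of_ne hj with hj | hj
  · exact Polynomial.coeff_eq_zero_of_lt_natTrailingDegree (by omega)
  · exact Polynomial.coeff_eq_zero_of_natDegree_lt hj

lemma aux_gauss (N : ℕ) : 0 < N → ∀ A d e : MvPolynomial (Fin 2) ℤ,
    MvPolynomial.C (N : ℤ) * A = d * e →
    ∃ (d' e' : MvPolynomial (Fin 2) ℤ) (a : ℤ), A = d' * e' ∧ d = MvPolynomial.C a * d' := by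
  induction N using induction_on_primes with
  | zero => intro h; omega
  | one => intro _ A d e h; exact ⟨d, e, 1, by simpa using h, by simp⟩
  | prime_mul p N hp ih =>
    intro hN A d e h
    have hN' : 0 < N := Nat.pos_of_mul_pos_left hN
    have hpp : Prime (MvPolynomial.C (p : ℤ) : MvPolynomial (Fin 2) ℤ) :=
      (MvPolynomial.prime_C_iff (Fin 2)).2 (Nat.prime_iff_prime_int.1 hp)
    have h' : MvPolynomial.C (p : ℤ) * (MvPolynomial.C (N : ℤ) * A) = d * e := by
      rw [← h]; push_cast; rw [map_mul]; ring
    rcases hpp.dvd_or_dvd ⟨_, h'.symm⟩ with ⟨d1, rfl⟩ | ⟨e1, rfl⟩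
    · obtain ⟨d', e', a, h1, h2⟩ := ih hN' A d1 e (by
        apply mul_left_cancel₀ hpp.ne_zero
        rw [h']; ring)
      exact ⟨d', e', p * a, h1, by rw [h2, map_mul]; ring⟩
    · obtain ⟨d', e', a, h1, h2⟩ := ih hN' A d e1 (by
        apply mul_left_cancel₀ hpp.ne_zero
        rw [h']; ring)
      exact ⟨d', e', a, h1, h2⟩

lemma aux_clear_denoms (p : MvPolynomial (Fin 2) ℚ) :
    ∃ (N : ℕ) (p1 : MvPolynomial (Fin 2) ℤ), 0 < N ∧
      MvPolynomial.map (Int.castRingHom ℚ) p1 = MvPolynomial.C (N : ℚ) * p := by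
  induction p using MvPolynomial.induction_on' with
  | monomial m r =>
    refine ⟨r.den, monomial m r.num, r.den_pos, ?_⟩
    rw [map_monomial, C_mul_monomial, Rat.den_mul_eq_num]
    rfl
  | add p q hp hq =>
    obtain ⟨N, p1, hN, h1⟩ := hp
    obtain ⟨M, q1, hM, h2⟩ := hq
    refine ⟨N * M, MvPolynomial.C (M : ℤ) * p1 + MvPolynomial.C (N : ℤ) * q1, by positivity, ?_⟩
    rw [map_add, map_mul, map_mul, h1, h2]
    simp
    ring

lemma aux_hom_eval (G : MvPolynomial (Fin 2) ℤ) (n : ℕ) (hG : G.IsHomogeneous n) :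
    ∃ c : ℕ → ℤ, ∀ x y : ℝ, evalReal G x y
      = ∑ j ∈ Finset.range (n + 1), (c j : ℝ) * x ^ j * y ^ (n - j) := by
  let e : ℕ → (Fin 2 →₀ ℕ) := fun j => Finsupp.single 0 j + Finsupp.single 1 (n - j)
  refine ⟨fun j => coeff (e j) G, fun x y => ?_⟩
  have hsum : G = ∑ j ∈ Finset.range (n + 1), monomial (e j) (coeff (e j) G) := by
    ext m
    rw [coeff_sum]
    simp only [coeff_monomial]
    by_cases hm : m.degree = n
    · have hm' : m 0 + m 1 = n := by
        rw [Finsupp.degree_eq_sum, Fin.sum_univ_two] at hm; exact hm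
      have hem : e (m 0) = m := by
        ext i
        fin_cases i
        · simp [e]
        · simp [e]; omega
      rw [Finset.sum_eq_single (m 0)]
      · rw [if_pos hem, hem]
      · intro j _ hj
        rw [if_neg]
        intro h
        apply hj
        rw [← h]; simp [e]
      · intro h; simp at h; omega
    · rw [hG.coeff_eq_zero hm]
      symm
      apply Finset.sum_eq_zero
      intro j hj
      rw [if_neg]
      intro h
      apply hm
      rw [← h, Finsupp.degree_eq_sum, Fin.sum_univ_two]
      simp [e]
      simp at hj
      omega
  conv_lhs => rw [evalReal, hsum]
  rw [map_sum]
  apply Finset.sum_congr rfl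
  intro j _
  rw [aeval_monomial, Finsupp.prod_fintype _ _ (by simp), Fin.prod_univ_two]
  simp [e]
  ring

lemma aux_evalReal_toQ (G : MvPolynomial (Fin 2) ℤ) (x y : ℝ) :
    (aeval ![x, y] (toQ G) : ℝ) = evalReal G x y := by
  rw [evalReal, toQ, aeval_def, eval₂_map, aeval_def]
  congr 1

lemma aux_continuous (G : MvPolynomial (Fin 2) ℤ) :
    Continuous (fun v : ℝ × ℝ => evalReal G v.1 v.2) := by
  have h : ∀ v : ℝ × ℝ, evalReal G v.1 v.2 = eval ![v.1, v.2] (map (algebraMap ℤ ℝ) G) := by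
    intro v
    rw [evalReal, eval_map, aeval_def]
  simp only [h]
  apply (MvPolynomial.continuous_eval _).comp
  fun_prop

lemma aux_definite (G : MvPolynomial (Fin 2) ℤ)
    (h : ∀ x y : ℝ, (x, y) ≠ (0, 0) → evalReal G x y ≠ 0) : PosDef2 G ∨ PosDef2 (-G) := by
  have hconn : IsPreconnected ({0}ᶜ : Set (ℝ × ℝ)) :=
    (isConnected_compl_singleton_of_one_lt_rank (by simp [one_add_one_eq_two]) 0).isPreconnected
  have hcont := (aux_continuous G).continuousOn (s := ({0}ᶜ : Set (ℝ × ℝ)))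
  by_contra! hcon
  obtain ⟨h1, h2⟩ := hcon
  simp only [PosDef2, not_forall, not_lt] at h1 h2
  obtain ⟨x1, y1, n1, l1⟩ := h1
  obtain ⟨x2, y2, n2, l2⟩ := h2
  have l2' : 0 ≤ evalReal G x2 y2 := by
    have : evalReal (-G) x2 y2 = - evalReal G x2 y2 := by simp [evalReal]
    linarith
  obtain ⟨v, hv, hv0⟩ := hconn.intermediate_value (a := (x1, y1)) (b := (x2, y2)) n1 n2 hcont
    ⟨l1, l2'⟩
  exact h v.1 v.2 hv hv0

/-- A common factor must have a nontrivial real zero. -/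
lemma aux_real_zero (F4 Ft4 : MvPolynomial (Fin 2) ℤ) (hF4 : F4 ≠ 0) (ht : IsTildePart F4 Ft4)
    (d : MvPolynomial (Fin 2) ℚ) (hd : 0 < d.totalDegree) (hdvd : d ∣ toQ Ft4) :
    ∃ s t : ℝ, (s, t) ≠ (0, 0) ∧ (aeval ![s, t] d : ℝ) = 0 := by
  by_contra! hcon
  obtain ⟨P0, k, hP0, hPD, hmul, ⟨n, hn⟩, hprim, hmax⟩ := ht
  have hFt : Ft4 ≠ 0 := by rintro rfl; apply hF4; rw [hmul, mul_zero]
  obtain ⟨e, he⟩ := hdvd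
  obtain ⟨N, d1, hN, hd1⟩ := aux_clear_denoms d
  obtain ⟨M, e1, hM, he1⟩ := aux_clear_denoms e
  have hprod : MvPolynomial.C ((N * M : ℕ) : ℤ) * Ft4 = d1 * e1 := by
    apply MvPolynomial.map_injective (Int.castRingHom ℚ) Int.cast_injective
    rw [map_mul, map_mul, hd1, he1]
    change _ * toQ Ft4 = _
    rw [he]
    simp
    ring
  obtain ⟨d', e', a, h1, h2⟩ := aux_gauss (N * M) (by positivity) _ _ _ hprod
  have hde : d' * e' ≠ 0 := h1 ▸ hFt
  obtain ⟨k1, hk1⟩ := aux_hom_of_mul d' e' n (h1 ▸ hn) hde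
  obtain ⟨k2, hk2⟩ := aux_hom_of_mul e' d' n (by rw [mul_comm]; exact h1 ▸ hn)
    (by rw [mul_comm]; exact hde)
  have hNQ : (N : ℚ) ≠ 0 := by exact_mod_cast hN.ne'
  have hdd : d = MvPolynomial.C ((N : ℚ)⁻¹ * a) * toQ d' := by
    have : MvPolynomial.C (N : ℚ) * d = MvPolynomial.C (a : ℚ) * toQ d' := by
      rw [← hd1, h2, map_mul]; simp [toQ]
    rw [map_mul, mul_assoc, ← this, ← mul_assoc, ← map_mul, inv_mul_cancel₀ hNQ]
    simp
  have hk1pos : 0 < k1 := by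
    rcases Nat.eq_zero_or_pos k1 with h | h
    · exfalso
      subst h
      have hh : d.IsHomogeneous 0 := by
        rw [hdd]
        exact (hk1.map (Int.castRingHom ℚ)).C_mul _
      have := hh.totalDegree_le
      omega
    · exact h
  have hnz : ∀ x y : ℝ, (x, y) ≠ (0, 0) → evalReal d' x y ≠ 0 := by
    intro x y hxy h
    apply hcon x y hxy
    rw [hdd, map_mul, aux_evalReal_toQ, h, mul_zero]
  have hprim' : ∀ E : MvPolynomial (Fin 2) ℤ, E ∣ Ft4 → IsPrimitiveInt E := by
    rintro E ⟨E', hE⟩ r hr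
    apply hprim r
    rw [← C_dvd_iff_dvd_coeff] at hr ⊢
    rw [hE]
    exact hr.mul_right _
  have hfin : ∀ Q E : MvPolynomial (Fin 2) ℤ, Ft4 = Q * E → Q.IsHomogeneous k1 →
      E.IsHomogeneous k2 → PosDef2 Q → False := by
    intro Q E hQE hQ hE hpd
    have := hmax (P0 * Q) E (k + k1) (hP0.mul hQ) (by
        intro x y hxy
        have e1 : evalReal (P0 * Q) x y = evalReal P0 x y * evalReal Q x y := by simp [evalReal]
        rw [e1]
        exact mul_pos (hPD x y hxy) (hpd x y hxy))
      (by rw [hmul, hQE]; ring) ⟨k2, hE⟩ (hprim' E ⟨Q, by rw [hQE]; ring⟩)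
    omega
  rcases aux_definite d' hnz with h | h
  · exact hfin d' e' h1 hk1 hk2 h
  · exact hfin (-d') (-e') (by rw [h1]; ring) hk1.neg hk2.neg h

/-- **Proposition 2.8.** Suppose `F ∈ ℤ[x,y]` has degree 4, `F(0,0) = 0`,
the degree-4 part `F₄` is positive semi-definite and `gcd(F̃₄, F₃, F₂, F₁) ≠ 1`.
Then `F(ℤ²) ≠ (Cℤ)_{≥D}` for every `C ∈ ℕ`, `D ∈ ℤ`. -/
theorem gcd_four_value_set_ne
    (F : MvPolynomial (Fin 2) ℤ) (hdeg : F.totalDegree = 4)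
    (h0 : MvPolynomial.eval ![0, 0] F = 0)
    (hpsd : PosSemidef2 (MvPolynomial.homogeneousComponent 4 F))
    (Ft4 : MvPolynomial (Fin 2) ℤ)
    (htilde : IsTildePart (MvPolynomial.homogeneousComponent 4 F) Ft4)
    (hgcd4 : CommonFactor4 Ft4 (MvPolynomial.homogeneousComponent 3 F)
      (MvPolynomial.homogeneousComponent 2 F) (MvPolynomial.homogeneousComponent 1 F))
    (C : ℤ) (hC : 0 < C) (D : ℤ) :
    valueSet F ≠ targetSet C D := by
  intro hset
  obtain ⟨d, hd, dv4, dv3, dv2, dv1⟩ := hgcd4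
  have hF4 : homogeneousComponent 4 F ≠ 0 := by
    intro h
    have h1 : F = ∑ i ∈ Finset.range 5, homogeneousComponent i F := by
      conv_lhs => rw [← sum_homogeneousComponent F, hdeg]
    rw [Finset.sum_range_succ, h, add_zero] at h1
    have h2 : F.totalDegree ≤ 3 := by
      rw [h1]
      refine totalDegree_finsetSum_le (fun i hi => ?_)
      have := (homogeneousComponent_isHomogeneous i F).totalDegree_le
      simp at hi
      omega
    omega
  obtain ⟨s, t, hst, hz⟩ := aux_real_zero _ Ft4 hF4 htilde d hd dv4
  have hzero : ∀ G : MvPolynomial (Fin 2) ℤ, d ∣ toQ G → evalReal G s t = 0 := by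
    rintro G ⟨e, he⟩
    rw [← aux_evalReal_toQ, he, map_mul, hz, zero_mul]
  obtain ⟨P0, _, _, _, hmul, _⟩ := htilde
  have v4 : evalReal (homogeneousComponent 4 F) s t = 0 := by
    have h1 := hzero Ft4 dv4
    rw [hmul]
    rw [evalReal] at h1 ⊢
    rw [map_mul, h1, mul_zero]
  have v3 := hzero _ dv3
  have v2 := hzero _ dv2
  have v1 := hzero _ dv1
  obtain ⟨a, ha⟩ := aux_hom_eval _ 4 (homogeneousComponent_isHomogeneous 4 F)
  obtain ⟨b, hb⟩ := aux_hom_eval _ 3 (homogeneousComponent_isHomogeneous 3 F)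
  obtain ⟨c, hc⟩ := aux_hom_eval _ 2 (homogeneousComponent_isHomogeneous 2 F)
  obtain ⟨e, he⟩ := aux_hom_eval _ 1 (homogeneousComponent_isHomogeneous 1 F)
  simp only [Finset.sum_range_succ, Finset.sum_range_zero] at ha hb hc he
  norm_num at ha hb hc he
  have hcast : ∀ x y : ℤ, ((eval ![x, y] F : ℤ) : ℝ) = evalReal F x y := by
    intro x y
    rw [evalReal, aeval_def]
    have := MvPolynomial.eval₂_comp_left (Int.castRingHom ℝ) (RingHom.id ℤ) ![x, y] F
    rw [MvPolynomial.eval, MvPolynomial.coe_eval₂Hom]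
    rw [show ((eval₂ (RingHom.id ℤ) ![x, y] F : ℤ) : ℝ)
      = (Int.castRingHom ℝ) (eval₂ (RingHom.id ℤ) ![x, y] F) from rfl, this]
    congr 1
    funext i
    fin_cases i <;> simp
  have hc0 : homogeneousComponent 0 F = 0 := by
    rw [homogeneousComponent_zero]
    have h1 : (![0, 0] : Fin 2 → ℤ) = 0 := by
      funext i
      fin_cases i <;> rfl
    rw [h1, MvPolynomial.eval_zero] at h0
    rw [← constantCoeff_eq, h0, map_zero]
  have hsplit : ∀ x y : ℝ, evalReal F x y = evalReal (homogeneousComponent 4 F) x y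
      + evalReal (homogeneousComponent 3 F) x y + evalReal (homogeneousComponent 2 F) x y
      + evalReal (homogeneousComponent 1 F) x y := by
    intro x y
    have h1 : F = ∑ i ∈ Finset.range 5, homogeneousComponent i F := by
      conv_lhs => rw [← sum_homogeneousComponent F, hdeg]
    conv_lhs => rw [h1]
    simp only [Finset.sum_range_succ, Finset.sum_range_zero, hc0, evalReal, map_add, map_zero]
    ring
  refine aux_final (a 0) (a 1) (a 2) (a 3) (a 4) (b 0) (b 1) (b 2) (b 3) (c 0) (c 1) (c 2)
    (e 0) (e 1) C D hC ?_ ?_ s t ?_ ?_ ?_ ?_ ?_ (fun x y => eval ![x, y] F) ?_ ?_ ?_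
  · intro x y
    have := hpsd x y
    rw [ha] at this
    linarith
  · rintro ⟨z0, z1, z2, z3, z4⟩
    apply hF4
    apply MvPolynomial.map_injective (algebraMap ℤ ℝ) (algebraMap ℤ ℝ).injective_int
    rw [map_zero]
    apply MvPolynomial.funext
    intro v
    have h1 := ha (v 0) (v 1)
    rw [z0, z1, z2, z3, z4] at h1
    have h2 : ![v 0, v 1] = v := by
      funext i
      fin_cases i <;> rfl
    rw [evalReal, h2] at h1
    rw [eval_map, map_zero, ← aeval_def, h1]
    simp
  · rintro ⟨rfl, rfl⟩
    exact hst rfl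
  · rw [ha] at v4; linarith
  · rw [hb] at v3; linarith
  · rw [hc] at v2; linarith
  · rw [he] at v1; linarith
  · intro x y
    have h1 := hcast x y
    rw [hsplit, ha, hb, hc, he] at h1
    have h2 : ((eval ![x, y] F : ℤ) : ℝ) = ((a 4 * x ^ 4 + a 3 * x ^ 3 * y + a 2 * x ^ 2 * y ^ 2
      + a 1 * x * y ^ 3 + a 0 * y ^ 4
      + (b 3 * x ^ 3 + b 2 * x ^ 2 * y + b 1 * x * y ^ 2 + b 0 * y ^ 3)
      + (c 2 * x ^ 2 + c 1 * x * y + c 0 * y ^ 2) + (e 1 * x + e 0 * y) : ℤ) : ℝ) := by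
      rw [h1]; push_cast; ring
    exact_mod_cast h2
  · intro x y
    have : eval ![x, y] F ∈ targetSet C D := by rw [← hset]; exact ⟨x, y, rfl⟩
    exact this.2
  · intro n hn
    have : C * n ∈ valueSet F := by rw [hset]; exact ⟨⟨n, rfl⟩, hn⟩
    exact this
end

section
/- Let F ∈ ℤ[x,y] have total degree 4 with F(0,0) = 0 and be linked (so F_4 is positive semi-definite, gcd(F̃_4, F_3) ≠ 1, gcd(F̃_4, F_3, F_2) = 1), with F_3 not the zero polynomial, and suppose that F_2(cos ξ, sin ξ) > 0 for every ξ in Ξ. For each ξ ∈ Ξ, let r_ξ denote half the multiplicity with which the real linear form sin(ξ)x − cos(ξ)y divides F_4 (this multiplicity is even), and let s_ξ denote the multiplicity with which sin(ξ)x − cos(ξ)y divides F_3. If r_ξ ≠ s_ξ for every ξ ∈ Ξ, then either there exists λ > 0 such that #ℛ_F([N,2N]) ≪ N^{1−λ}, or the infimum of F(x,y) over (x,y) ∈ ℤ² is −∞. -/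
open MvPolynomial

/-- The image of an integral polynomial in `ℝ[x,y]`. -/
noncomputable def toR (G : MvPolynomial (Fin 2) ℤ) : MvPolynomial (Fin 2) ℝ :=
  MvPolynomial.map (Int.castRingHom ℝ) G

/-- The real linear form `sin(ξ)·x - cos(ξ)·y`. -/
noncomputable def linForm (ξ : ℝ) : MvPolynomial (Fin 2) ℝ :=
  MvPolynomial.C (Real.sin ξ) * MvPolynomial.X 0 -
    MvPolynomial.C (Real.cos ξ) * MvPolynomial.X 1

/-- The grading homomorphism `X_i ↦ X_i T`. -/
noncomputable def gradHom : MvPolynomial (Fin 2) ℚ →+* Polynomial (MvPolynomial (Fin 2) ℚ) :=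
  MvPolynomial.eval₂Hom (Polynomial.C.comp MvPolynomial.C)
    (fun i => Polynomial.C (MvPolynomial.X i) * Polynomial.X)

lemma gradHom_monomial (d : Fin 2 →₀ ℕ) (a : ℚ) :
    gradHom (monomial d a) = Polynomial.C (monomial d a) * Polynomial.X ^ d.degree := by
  have h1 : (monomial d a : MvPolynomial (Fin 2) ℚ) = C a * X 0 ^ d 0 * X 1 ^ d 1 := by
    rw [MvPolynomial.monomial_eq, Finsupp.prod_fintype _ _ (by simp), Fin.prod_univ_two, mul_assoc]
  have h2 : d.degree = d 0 + d 1 := by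
    rw [Finsupp.degree_eq_sum, Fin.sum_univ_two]
  rw [h1, h2]
  simp only [gradHom, map_mul, map_pow, coe_eval₂Hom, eval₂_C, eval₂_X, RingHom.comp_apply]
  ring

lemma gradHom_coeff (f : MvPolynomial (Fin 2) ℚ) (n : ℕ) :
    (gradHom f).coeff n = homogeneousComponent n f := by
  induction f using MvPolynomial.induction_on' with
  | monomial d c =>
    rw [gradHom_monomial, homogeneousComponent_of_mem (isHomogeneous_monomial c rfl),
      Polynomial.coeff_C_mul_X_pow]
  | add p q hp hq => simp [map_add, hp, hq]

lemma gradHom_inj : Function.Injective gradHom := by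
  intro f g h
  rw [← sum_homogeneousComponent f, ← sum_homogeneousComponent g]
  have : ∀ n, homogeneousComponent n f = homogeneousComponent n g := by
    intro n; rw [← gradHom_coeff, ← gradHom_coeff, h]
  ext d
  have := congrArg (coeff d) (this d.degree)
  simp only [coeff_homogeneousComponent, if_true] at this
  simpa [sum_homogeneousComponent] using this

lemma gradHom_homog {f : MvPolynomial (Fin 2) ℚ} {n : ℕ} (h : f.IsHomogeneous n) :
    gradHom f = Polynomial.monomial n f := by
  ext1 m
  rw [gradHom_coeff, homogeneousComponent_of_mem h, Polynomial.coeff_monomial]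
  simp [eq_comm]

lemma homog_of_mul {f g : MvPolynomial (Fin 2) ℚ} {N : ℕ} (h : (f * g).IsHomogeneous N)
    (hne : f * g ≠ 0) : ∃ n, f.IsHomogeneous n := by
  have hf : gradHom f ≠ 0 := by
    intro h; apply hne
    rw [gradHom_inj (h.trans (map_zero gradHom).symm), zero_mul]
  have hg : gradHom g ≠ 0 := by
    intro h; apply hne
    rw [gradHom_inj (h.trans (map_zero gradHom).symm), mul_zero]
  have hm : gradHom f * gradHom g = Polynomial.monomial N (f * g) := by
    rw [← map_mul, gradHom_homog h]
  have h1 := Polynomial.natDegree_mul hf hg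
  have h2 := Polynomial.natTrailingDegree_mul hf hg
  rw [hm, Polynomial.natDegree_monomial_eq _ hne] at h1
  rw [hm, Polynomial.natTrailingDegree_monomial hne] at h2
  have h3 := Polynomial.natTrailingDegree_le_natDegree (gradHom f)
  have h4 := Polynomial.natTrailingDegree_le_natDegree (gradHom g)
  refine ⟨(gradHom f).natDegree, ?_⟩
  have h5 : ∀ n, n ≠ (gradHom f).natDegree → homogeneousComponent n f = 0 := by
    intro n hn
    rw [← gradHom_coeff]
    rcases lt_or_gt_of_ne hn with hl | hl
    · exact Polynomial.coeff_eq_zero_of_lt_natTrailingDegree (by omega)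
    · exact Polynomial.coeff_eq_zero_of_natDegree_lt hl
  intro d hd
  by_contra hc
  have hw : Finsupp.weight 1 d = d.degree := by
    rw [Finsupp.degree_eq_weight_one]; rfl
  rw [hw] at hc
  have := congrArg (coeff d) (h5 _ hc)
  simp only [coeff_homogeneousComponent, if_true, coeff_zero] at this
  exact hd this

lemma toQ_inj : Function.Injective toQ :=
  MvPolynomial.map_injective _ (RingHom.injective_int _)

lemma exists_clear (e : MvPolynomial (Fin 2) ℚ) :
    ∃ (n : ℤ) (E : MvPolynomial (Fin 2) ℤ), n ≠ 0 ∧ C (n : ℚ) * e = toQ E := by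
  induction e using MvPolynomial.induction_on with
  | C a =>
    refine ⟨a.den, C a.num, by simp, ?_⟩
    have h1 : toQ (C a.num) = C (a.num : ℚ) := by simp [toQ]
    rw [h1, ← C_mul]
    have h2 : ((a.den : ℤ) : ℚ) * a = a.num := by
      push_cast
      exact Rat.den_mul_eq_num a
    rw [h2]
  | add p q hp hq =>
    obtain ⟨n, E, hn, h⟩ := hp
    obtain ⟨m, E', hm, h'⟩ := hq
    refine ⟨n * m, C m * E + C n * E', mul_ne_zero hn hm, ?_⟩
    have : toQ (C m * E + C n * E') = C (m : ℚ) * toQ E + C (n : ℚ) * toQ E' := by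
      simp [toQ]
    rw [this, ← h, ← h']
    push_cast
    rw [C_mul]; ring
  | mul_X p i hp =>
    obtain ⟨n, E, hn, h⟩ := hp
    refine ⟨n, E * X i, hn, ?_⟩
    have : toQ (E * X i) = toQ E * X i := by simp [toQ]
    rw [this, ← h]; ring

lemma exists_prim (E : MvPolynomial (Fin 2) ℤ) (hE : E ≠ 0) :
    ∃ (g : ℤ) (E' : MvPolynomial (Fin 2) ℤ), g ≠ 0 ∧ E = C g * E' ∧ IsPrimitiveInt E' := by
  set g : ℤ := E.support.gcd (fun m => coeff m E) with hg
  have hdvd : C g ∣ E := by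
    rw [C_dvd_iff_dvd_coeff]
    intro i
    by_cases hi : i ∈ E.support
    · exact Finset.gcd_dvd hi
    · rw [notMem_support_iff.mp hi]; exact dvd_zero _
  obtain ⟨E', hE'⟩ := hdvd
  have hg0 : g ≠ 0 := by
    rintro h; rw [h] at hE'; apply hE; rw [hE']; simp
  refine ⟨g, E', hg0, hE', ?_⟩
  intro d hd
  have : g * d ∣ g := by
    conv_rhs => rw [hg]
    apply Finset.dvd_gcd
    intro m _
    rw [hE', coeff_C_mul]
    exact mul_dvd_mul_left _ (hd m)
  have h2 : g * d ∣ g * 1 := by simpa using this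
  exact isUnit_of_dvd_one ((mul_dvd_mul_iff_left hg0).mp h2)

lemma gauss_aux (e A : MvPolynomial (Fin 2) ℤ) (he : IsPrimitiveInt e) (n : ℕ) :
    0 < n → ∀ D : MvPolynomial (Fin 2) ℤ, C (n : ℤ) * A = D * e → ∃ D', A = D' * e := by
  induction n using Nat.strong_induction_on with
  | _ n ih =>
    intro hn D h
    by_cases h1 : n = 1
    · subst h1; exact ⟨D, by simpa using h⟩
    · obtain ⟨p, hp, k, rfl⟩ := Nat.exists_prime_and_dvd h1
      have hpz : Prime (p : ℤ) := Nat.prime_iff_prime_int.mp hp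
      have hpC : Prime (C (p : ℤ) : MvPolynomial (Fin 2) ℤ) := (prime_C_iff _ ).mpr hpz
      have hd : C (p : ℤ) ∣ D * e := by
        rw [← h]; push_cast; rw [C_mul, mul_assoc]; exact dvd_mul_right _ _
      rcases hpC.dvd_or_dvd hd with hd | hd
      · obtain ⟨D1, rfl⟩ := hd
        have hk : 0 < k := Nat.pos_of_mul_pos_left hn
        refine ih k ?_ hk D1 ?_
        · nlinarith [hp.two_le]
        · apply mul_left_cancel₀ hpC.ne_zero
          rw [← mul_assoc, ← mul_assoc, ← h]; push_cast; rw [C_mul]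
      · exact absurd (he p ((C_dvd_iff_dvd_coeff _ _).mp hd)) hpz.not_isUnit

lemma gauss_int (e A : MvPolynomial (Fin 2) ℤ) (he : IsPrimitiveInt e) (n : ℤ) (hn : n ≠ 0)
    (D : MvPolynomial (Fin 2) ℤ) (h : C n * A = D * e) : ∃ D', A = D' * e := by
  apply gauss_aux e A he n.natAbs (Int.natAbs_pos.mpr hn) (C n.sign * D)
  rw [mul_assoc, ← h, ← mul_assoc, ← C_mul, Int.sign_mul_self_eq_natAbs]

lemma evalReal_mul (A B : MvPolynomial (Fin 2) ℤ) (x y : ℝ) :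
    evalReal (A * B) x y = evalReal A x y * evalReal B x y := by
  simp [evalReal]

lemma evalReal_neg (A : MvPolynomial (Fin 2) ℤ) (x y : ℝ) :
    evalReal (-A) x y = - evalReal A x y := by
  simp [evalReal]

lemma aeval_toQ (A : MvPolynomial (Fin 2) ℤ) (x y : ℝ) :
    MvPolynomial.aeval ![x, y] (toQ A) = evalReal A x y := by
  rw [toQ, evalReal, MvPolynomial.aeval_def, MvPolynomial.eval₂_map, MvPolynomial.aeval_def]
  congr 1

lemma evalReal_continuous (A : MvPolynomial (Fin 2) ℤ) :
    Continuous (fun z : ℝ × ℝ => evalReal A z.1 z.2) := by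
  unfold evalReal
  induction A using MvPolynomial.induction_on with
  | C a => simpa using continuous_const
  | add p q hp hq => simp only [map_add]; exact hp.add hq
  | mul_X p i hp =>
    simp only [map_mul, aeval_X]
    refine hp.mul ?_
    fin_cases i
    · exact continuous_fst
    · exact continuous_snd

lemma definite_of_no_zero (A : MvPolynomial (Fin 2) ℤ)
    (h : ∀ x y : ℝ, (x, y) ≠ (0, 0) → evalReal A x y ≠ 0) :
    PosDef2 A ∨ PosDef2 (-A) := by
  by_contra hc
  push Not at hc
  obtain ⟨h1, h2⟩ := hc
  simp only [PosDef2, not_forall, not_lt, evalReal_neg] at h1 h2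
  obtain ⟨x, y, hxy, h1⟩ := h1
  obtain ⟨x', y', hxy', h2⟩ := h2
  have hconn : IsConnected ({((0 : ℝ), (0 : ℝ))}ᶜ : Set (ℝ × ℝ)) :=
    isConnected_compl_singleton_of_one_lt_rank (by
      rw [← Module.finrank_eq_rank]; simp) _
  have := hconn.isPreconnected.intermediate_value (a := (x, y)) (b := (x', y'))
    (by simpa using hxy) (by simpa using hxy') (evalReal_continuous A).continuousOn
  obtain ⟨z, hz, hz0⟩ := this (show (0 : ℝ) ∈ _ from ⟨h1, by linarith⟩)
  exact h z.1 z.2 (by simpa using hz) hz0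

lemma exists_common_dir (F4 Ft4 F3 : MvPolynomial (Fin 2) ℤ) (hF4 : F4 ≠ 0)
    (htilde : IsTildePart F4 Ft4) (hgcd1 : CommonFactor2 Ft4 F3) :
    ∃ x y : ℝ, (x, y) ≠ (0, 0) ∧ evalReal Ft4 x y = 0 ∧ evalReal F3 x y = 0 := by
  obtain ⟨d, hd, ⟨e, he⟩, ⟨e3, he3⟩⟩ := hgcd1
  obtain ⟨P0, k, hP0, hpd, hF, ⟨n, hn⟩, hprim, hmax⟩ := htilde
  have hFt : Ft4 ≠ 0 := by rintro rfl; simp at hF; exact hF4 hF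
  have hFtQ : toQ Ft4 ≠ 0 := fun h => hFt (toQ_inj (by rw [h]; simp [toQ]))
  have he0 : e ≠ 0 := by rintro rfl; simp at he; exact hFtQ he
  by_contra hcon
  push Not at hcon
  have hdz : ∀ x y : ℝ, (x, y) ≠ (0, 0) → MvPolynomial.aeval ![x, y] d ≠ 0 := by
    intro x y hxy h
    apply hcon x y hxy
    · rw [← aeval_toQ, he, map_mul, h, zero_mul]
    · rw [← aeval_toQ, he3, map_mul, h, zero_mul]
  have hhom : (toQ Ft4).IsHomogeneous n := hn.map _
  obtain ⟨nd, hnd⟩ := homog_of_mul (he ▸ hhom) (he ▸ hFtQ)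
  obtain ⟨ne, hne⟩ := homog_of_mul (mul_comm d e ▸ he ▸ hhom) (mul_comm d e ▸ he ▸ hFtQ)
  have hd0 : d ≠ 0 := by rintro rfl; simp at hd
  have hnd' : d.totalDegree = nd := hnd.totalDegree hd0
  obtain ⟨a, D, ha, haD⟩ := exists_clear d
  obtain ⟨b, E, hb, hbE⟩ := exists_clear e
  have hE0 : E ≠ 0 := by
    rintro rfl
    have : toQ 0 = 0 := by simp [toQ]
    rw [this, mul_eq_zero] at hbE
    rcases hbE with h | h
    · rw [C_eq_zero] at h; exact hb (by exact_mod_cast h)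
    · exact he0 h
  obtain ⟨g, E', hg, hgE, hE'⟩ := exists_prim E hE0
  have hEQ : toQ E = C (g : ℚ) * toQ E' := by rw [hgE]; simp [toQ]
  have hkey : C (a * b) * Ft4 = (C g * D) * E' := by
    apply toQ_inj
    have e1 : toQ (C (a * b) * Ft4) = C (a : ℚ) * C (b : ℚ) * toQ Ft4 := by simp [toQ]
    have e2 : toQ ((C g * D) * E') = C (g : ℚ) * toQ D * toQ E' := by simp [toQ]
    rw [e1, e2, he, ← haD]
    have := hbE.trans hEQ
    linear_combination (C (a : ℚ) * d) * this
  obtain ⟨D', hD'⟩ := gauss_int E' Ft4 hE' (a * b) (mul_ne_zero ha hb) _ hkey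
  have hE'0 : E' ≠ 0 := by rintro rfl; simp at hD'; exact hFt hD'
  have hDD : C (a * b) * D' = C g * D := by
    apply mul_right_cancel₀ hE'0
    rw [← hkey, hD']; ring
  have hDDQ : C ((a * b : ℤ) : ℚ) * toQ D' = C ((g * a : ℤ) : ℚ) * d := by
    have := congrArg toQ hDD
    have e1 : toQ (C (a * b) * D') = C ((a * b : ℤ) : ℚ) * toQ D' := by simp [toQ]
    have e2 : toQ (C g * D) = C (g : ℚ) * toQ D := by simp [toQ]
    rw [e1, e2, ← haD] at this
    rw [this]; push_cast; rw [C_mul]; ring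
  have hD'hom : D'.IsHomogeneous nd := by
    have h1 : (toQ D').IsHomogeneous nd := by
      have : toQ D' = C (((a * b : ℤ) : ℚ)⁻¹ * ((g * a : ℤ) : ℚ)) * d := by
        rw [C_mul, mul_assoc, ← hDDQ, ← mul_assoc, ← C_mul, inv_mul_cancel₀ (by
          exact_mod_cast mul_ne_zero ha hb)]
        simp
      rw [this]; exact hnd.C_mul _
    exact h1.of_map (RingHom.injective_int _)
  have hE'hom : E'.IsHomogeneous ne := by
    have h1 : (toQ E').IsHomogeneous ne := by
      have hg' : (g : ℚ) ≠ 0 := by exact_mod_cast hg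
      have : toQ E' = C ((g : ℚ)⁻¹ * (b : ℚ)) * e := by
        rw [C_mul, mul_assoc, hbE, hEQ, ← mul_assoc, ← C_mul, inv_mul_cancel₀ hg']
        simp
      rw [this]; exact hne.C_mul _
    exact h1.of_map (RingHom.injective_int _)
  have hD'nz : ∀ x y : ℝ, (x, y) ≠ (0, 0) → evalReal D' x y ≠ 0 := by
    intro x y hxy h
    have := congrArg (MvPolynomial.aeval ![x, y]) hDDQ
    rw [map_mul, aeval_toQ, h, mul_zero, map_mul, aeval_C] at this
    have h2 := this.symm
    rw [mul_eq_zero] at h2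
    rcases h2 with h2 | h2
    · have : ((g * a : ℤ) : ℚ) = 0 := by simpa using h2
      exact mul_ne_zero hg ha (by exact_mod_cast this)
    · exact hdz x y hxy h2
  have hposmul : ∀ A B, PosDef2 A → PosDef2 B → PosDef2 (A * B) := by
    intro A B hA hB x y hxy
    rw [evalReal_mul]; exact mul_pos (hA x y hxy) (hB x y hxy)
  rcases definite_of_no_zero D' hD'nz with h | h
  · have := hmax (P0 * D') E' (k + nd) (hP0.mul hD'hom) (hposmul _ _ hpd h)
      (by rw [hF, hD']; ring) ⟨ne, hE'hom⟩ hE'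
    omega
  · have := hmax (P0 * -D') (-E') (k + nd) (hP0.mul hD'hom.neg) (hposmul _ _ hpd h)
      (by rw [hF, hD']; ring) ⟨ne, hE'hom.neg⟩ (by
        intro d hd
        exact hE' d (fun m => by simpa using hd m))
    omega

lemma evalReal_hom {G : MvPolynomial (Fin 2) ℤ} {n : ℕ} (hG : G.IsHomogeneous n) :
    ∃ a : ℕ → ℤ, ∀ x y : ℝ,
      evalReal G x y = ∑ i ∈ Finset.range (n + 1), (a i : ℝ) * x ^ (n - i) * y ^ i := by
  classical
  let φ : ℕ → (Fin 2 →₀ ℕ) := fun i => Finsupp.single 0 (n - i) + Finsupp.single 1 i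
  have φ0 : ∀ i, φ i 0 = n - i := by intro i; simp [φ]
  have φ1 : ∀ i, φ i 1 = i := by intro i; simp [φ]
  refine ⟨fun i => coeff (φ i) G, fun x y => ?_⟩
  have hinj : Function.Injective φ := by
    intro i j h
    have := congrArg (fun f => f 1) h
    simpa [φ1] using this
  have hsub : G.support ⊆ (Finset.range (n + 1)).image φ := by
    intro d hd
    have hdeg : d 0 + d 1 = n := by
      have h1 : d.degree = n := by
        by_contra hc
        exact (mem_support_iff.mp hd) (hG.coeff_eq_zero hc)
      rw [← h1, Finsupp.degree_eq_sum, Fin.sum_univ_two]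
    rw [Finset.mem_image]
    refine ⟨d 1, by simp; omega, ?_⟩
    ext i
    fin_cases i
    · show φ (d 1) 0 = d 0
      rw [φ0]; omega
    · show φ (d 1) 1 = d 1
      rw [φ1]
  rw [evalReal, aeval_def, eval₂_eq', Finset.sum_subset hsub, Finset.sum_image hinj.injOn]
  · apply Finset.sum_congr rfl
    intro i _
    rw [Fin.prod_univ_two, φ0, φ1]
    simp [mul_assoc]
  · intro d _ hd
    rw [notMem_support_iff.mp hd]; simp

lemma evalReal_scale {G : MvPolynomial (Fin 2) ℤ} {n : ℕ} (hG : G.IsHomogeneous n) (r x y : ℝ) :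
    evalReal G (r * x) (r * y) = r ^ n * evalReal G x y := by
  obtain ⟨a, ha⟩ := evalReal_hom hG
  rw [ha, ha, Finset.mul_sum]
  apply Finset.sum_congr rfl
  intro i hi
  have : i ≤ n := by simp at hi; omega
  rw [mul_pow, mul_pow, ← Nat.sub_add_cancel this, pow_add, Nat.sub_add_cancel this]
  ring

lemma evalReal_int (G : MvPolynomial (Fin 2) ℤ) (x y : ℤ) :
    evalReal G x y = ((MvPolynomial.eval ![x, y] G : ℤ) : ℝ) := by
  unfold evalReal
  induction G using MvPolynomial.induction_on with
  | C a => simp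
  | add p q hp hq => simp only [map_add, hp, hq, Int.cast_add]
  | mul_X p i hp =>
    simp only [map_mul, hp, aeval_X, eval_X, Int.cast_mul]
    fin_cases i <;> simp

lemma evalReal_toR (G : MvPolynomial (Fin 2) ℤ) (x y : ℝ) :
    MvPolynomial.eval ![x, y] (toR G) = evalReal G x y := by
  rw [toR, evalReal, MvPolynomial.eval_map, aeval_def]
  congr 1

lemma eq_zero_of_evalReal {G : MvPolynomial (Fin 2) ℤ} (h : ∀ x y, evalReal G x y = 0) :
    G = 0 := by
  have h1 : toR G = 0 := by
    apply MvPolynomial.funext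
    intro v
    have : v = ![v 0, v 1] := by ext i; fin_cases i <;> rfl
    rw [this, evalReal_toR, h, map_zero]
  exact MvPolynomial.map_injective _ (RingHom.injective_int _) (by
    rw [map_zero]; exact h1)

lemma exists_angle (x y : ℝ) (h : (x, y) ≠ (0, 0)) :
    ∃ ξ ρ : ℝ, ξ ∈ Set.Ico 0 (2 * Real.pi) ∧ 0 < ρ ∧ x = ρ * Real.cos ξ ∧ y = ρ * Real.sin ξ := by
  set z : ℂ := ⟨x, y⟩
  have hz : z ≠ 0 := by
    intro h0
    apply h
    have h1 := congrArg Complex.re h0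
    have h2 := congrArg Complex.im h0
    simp [z] at h1 h2
    simp [h1, h2]
  have hx : x = ‖z‖ * Real.cos z.arg := (Complex.norm_mul_cos_arg z).symm
  have hy : y = ‖z‖ * Real.sin z.arg := (Complex.norm_mul_sin_arg z).symm
  by_cases ha : 0 ≤ z.arg
  · exact ⟨z.arg, ‖z‖, ⟨ha, by linarith [Complex.arg_le_pi z, Real.pi_pos]⟩, norm_pos_iff.mpr hz,
      hx, hy⟩
  · refine ⟨z.arg + 2 * Real.pi, ‖z‖, ⟨by linarith [Complex.neg_pi_lt_arg z, Real.pi_pos],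
      by linarith⟩, norm_pos_iff.mpr hz, ?_, ?_⟩
    · rw [Real.cos_add_two_pi]; exact hx
    · rw [Real.sin_add_two_pi]; exact hy

lemma dvd_lin (G : MvPolynomial (Fin 2) ℤ) (ξ : ℝ) (k : ℕ) (Q : MvPolynomial (Fin 2) ℝ)
    (h : ∀ x y : ℝ, evalReal G x y =
      (Real.sin ξ * x - Real.cos ξ * y) ^ k * MvPolynomial.eval ![x, y] Q) :
    linForm ξ ^ k ∣ toR G := by
  refine ⟨Q, ?_⟩
  apply MvPolynomial.funext
  intro v
  have : v = ![v 0, v 1] := by ext i; fin_cases i <;> rfl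
  rw [this, evalReal_toR, h]
  simp [linForm]

lemma lin_dvd (G : MvPolynomial (Fin 2) ℤ) (ξ : ℝ) (k : ℕ) (P : Polynomial ℝ)
    (h : ∀ u : ℝ, evalReal G (Real.cos ξ + Real.sin ξ * u) (Real.sin ξ - Real.cos ξ * u) = P.eval u)
    (hd : linForm ξ ^ k ∣ toR G) : Polynomial.X ^ k ∣ P := by
  let φ : MvPolynomial (Fin 2) ℝ →ₐ[ℝ] Polynomial ℝ := MvPolynomial.aeval
    ![Polynomial.C (Real.cos ξ) + Polynomial.C (Real.sin ξ) * Polynomial.X,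
      Polynomial.C (Real.sin ξ) - Polynomial.C (Real.cos ξ) * Polynomial.X]
  have h1 : φ (linForm ξ) = Polynomial.X := by
    have hsc : (Polynomial.C (Real.sin ξ)) ^ 2 + (Polynomial.C (Real.cos ξ)) ^ 2
        = (1 : Polynomial ℝ) := by
      rw [← Polynomial.C_pow, ← Polynomial.C_pow, ← Polynomial.C_add, Real.sin_sq_add_cos_sq,
        Polynomial.C_1]
    simp only [φ, linForm, map_sub, map_mul, aeval_X, MvPolynomial.algHom_C,
      Polynomial.algebraMap_eq, Matrix.cons_val_zero, Matrix.cons_val_one]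
    linear_combination Polynomial.X * hsc
  have h2 : φ (toR G) = P := by
    apply Polynomial.funext
    intro u
    rw [← h u, ← evalReal_toR]
    generalize toR G = R
    induction R using MvPolynomial.induction_on with
    | C a => simp [φ]
    | add p q hp hq => simp only [map_add, Polynomial.eval_add, hp, hq]
    | mul_X p i hp =>
      simp only [map_mul, Polynomial.eval_mul, hp, eval_X]
      congr 1
      fin_cases i <;> simp [φ]
  have := map_dvd φ hd
  rwa [map_pow, h1, h2] at this

lemma lin_zero (a S : ℝ) (r : ℝ → ℝ) (hS : 0 ≤ S) (hr : ∀ u, |u| ≤ 1 → r u ≤ S)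
    (h : ∀ u, 0 ≤ a * u + u ^ 2 * r u) : a = 0 := by
  by_contra ha
  set W := S + 1 + |a| with hW
  have hWp : 0 < W := by positivity
  have hu : |-a / W| ≤ 1 := by
    rw [abs_div, abs_neg, abs_of_pos hWp, div_le_one hWp]; linarith
  have h1 := h (-a / W)
  have h2 := hr _ hu
  have h3 : a * (-a / W) + (-a / W) ^ 2 * r (-a / W) ≤ a * (-a / W) + (-a / W) ^ 2 * S := by
    have := mul_le_mul_of_nonneg_left h2 (sq_nonneg (-a / W))
    linarith
  have h4 : a * (-a / W) + (-a / W) ^ 2 * S = -(a ^ 2 / W ^ 2) * (W - S) := by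
    field_simp; ring
  have h5 : 0 < a ^ 2 / W ^ 2 := by positivity
  have h6 : 0 < W - S := by have := abs_nonneg a; linarith
  nlinarith [mul_pos h5 h6]

/-- Consequences of positive semi-definiteness for a quartic in adapted coordinates. -/
lemma psd_quartic (g1 g2 g3 g4 : ℝ)
    (h : ∀ t u : ℝ, 0 ≤ g1 * t ^ 3 * u + g2 * t ^ 2 * u ^ 2 + g3 * t * u ^ 3 + g4 * u ^ 4) :
    g1 = 0 ∧ 0 ≤ g4 ∧ g3 ^ 2 ≤ 4 * g2 * g4 := by
  have hg1 : g1 = 0 := by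
    apply lin_zero g1 (|g2| + |g3| + |g4|) (fun u => g2 + g3 * u + g4 * u ^ 2) (by positivity)
    · intro u hu
      have a1 := le_abs_self g2
      have a2 : g3 * u ≤ |g3| := by
        calc g3 * u ≤ |g3 * u| := le_abs_self _
          _ = |g3| * |u| := abs_mul _ _
          _ ≤ |g3| * 1 := by gcongr
          _ = |g3| := mul_one _
      have a3 : g4 * u ^ 2 ≤ |g4| := by
        calc g4 * u ^ 2 ≤ |g4 * u ^ 2| := le_abs_self _
          _ = |g4| * |u| ^ 2 := by rw [abs_mul, abs_pow]
          _ ≤ |g4| * 1 ^ 2 := by gcongr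
          _ = |g4| := by ring
      show g2 + g3 * u + g4 * u ^ 2 ≤ _
      linarith
    · intro u
      have := h 1 u
      show 0 ≤ g1 * u + u ^ 2 * (g2 + g3 * u + g4 * u ^ 2)
      linarith
  subst hg1
  refine ⟨rfl, by simpa using h 0 1, ?_⟩
  have := discrim_le_zero (a := g2) (b := g3) (c := g4) (fun t => by
    have := h t 1
    linarith)
  unfold discrim at this
  linarith

lemma neg_cubic (α β γ : ℝ) (hα : α ≠ 0) (M : ℝ) :
    ∃ k : ℤ, α * (k : ℝ) ^ 3 + β * (k : ℝ) ^ 2 + γ * k < M := by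
  have key : ∀ A B C : ℝ, 0 < A → ∃ k : ℤ, -A * (k : ℝ) ^ 3 + B * (k : ℝ) ^ 2 + C * k < M := by
    intro A B C hA
    obtain ⟨k, hk⟩ := exists_nat_gt ((|B| + |C| + |M| + 1) / A + 1)
    refine ⟨k, ?_⟩
    push_cast
    have hS : 0 ≤ (|B| + |C| + |M| + 1) / A := by positivity
    have h1 : (1 : ℝ) ≤ k := by linarith
    have h2 : |B| + |C| + |M| + 1 < A * k := by
      rw [← div_lt_iff₀' hA]; linarith
    have hk2 : (k : ℝ) ≤ (k : ℝ) ^ 2 := by nlinarith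
    have h3 : (|B| + |C| + |M| + 1) * (k : ℝ) ^ 2 ≤ A * k * (k : ℝ) ^ 2 := by gcongr
    have h4 : B * (k : ℝ) ^ 2 ≤ |B| * (k : ℝ) ^ 2 := by gcongr; exact le_abs_self B
    have h5 : C * k ≤ |C| * (k : ℝ) ^ 2 := by
      calc C * k ≤ |C| * k := by gcongr; exact le_abs_self C
        _ ≤ _ := by gcongr
    have h6 : -M ≤ |M| * (k : ℝ) ^ 2 := by
      have := neg_abs_le M
      nlinarith [abs_nonneg M]
    nlinarith
  rcases lt_or_gt_of_ne hα with h | h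
  · obtain ⟨k, hk⟩ := key (-α) β γ (by linarith)
    exact ⟨k, by linarith⟩
  · obtain ⟨k, hk⟩ := key α β (-γ) h
    refine ⟨-k, ?_⟩
    push_cast
    nlinarith

lemma neg_quad (A B C : ℝ) (hA : A < 0) (M : ℝ) :
    ∃ k : ℤ, A * (k : ℝ) ^ 2 + B * k + C < M := by
  obtain ⟨k, hk⟩ := exists_nat_gt ((|B| + |C - M| + 1) / (-A) + 1)
  refine ⟨k, ?_⟩
  push_cast
  have hA' : 0 < -A := by linarith
  have hS : 0 ≤ (|B| + |C - M| + 1) / (-A) := by positivity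
  have h1 : (1 : ℝ) ≤ k := by linarith
  have h2 : |B| + |C - M| + 1 < (-A) * k := by
    rw [← div_lt_iff₀' hA']; linarith
  have h3 : (|B| + |C - M| + 1) * (k : ℝ) ≤ (-A) * k * (k : ℝ) := by gcongr
  have h4 : B * (k : ℝ) ≤ |B| * k := by gcongr; exact le_abs_self B
  have h6 : C - M ≤ |C - M| * k := by
    have := le_abs_self (C - M)
    nlinarith [abs_nonneg (C - M)]
  nlinarith

lemma quartic_bound (δ p q r : ℝ) (hδ : 0 < δ) :
    ∃ K, ∀ u : ℝ, δ / 2 * u ^ 4 - K ≤ δ * u ^ 4 + p * u ^ 3 - q * u ^ 2 + r * u := by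
  set R := 2 * p ^ 2 / δ + q + 1 with hR
  refine ⟨2 * R ^ 2 / δ + r ^ 2 / 4, fun u => ?_⟩
  have h1 : -(δ / 8) * u ^ 4 - 2 * p ^ 2 / δ * u ^ 2 ≤ p * u ^ 3 := by
    have : p * u ^ 3 + (δ / 8) * u ^ 4 + 2 * p ^ 2 / δ * u ^ 2 = u ^ 2 / (8 * δ) * (δ * u + 4 * p) ^ 2 := by
      field_simp; ring
    have h : 0 ≤ u ^ 2 / (8 * δ) * (δ * u + 4 * p) ^ 2 := by positivity
    linarith
  have h2 : R * u ^ 2 ≤ δ / 8 * u ^ 4 + 2 * R ^ 2 / δ := by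
    have : δ / 8 * u ^ 4 + 2 * R ^ 2 / δ - R * u ^ 2 = 1 / (8 * δ) * (δ * u ^ 2 - 4 * R) ^ 2 := by
      field_simp; ring
    have h : 0 ≤ 1 / (8 * δ) * (δ * u ^ 2 - 4 * R) ^ 2 := by positivity
    linarith
  have h3 : -u ^ 2 - r ^ 2 / 4 ≤ r * u := by nlinarith [sq_nonneg (u + r / 2)]
  have h4 : 0 ≤ δ * u ^ 4 := by positivity
  have h5 : R * u ^ 2 = 2 * p ^ 2 / δ * u ^ 2 + q * u ^ 2 + u ^ 2 := by rw [hR]; ring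
  linarith

/-- Lower bound for `F` in adapted coordinates. -/
lemma lower_bound (δ σ h2 h3 e0 e1 e2 l0 l1 : ℝ) (hδ : 0 < δ) (hσ : 0 ≤ σ)
    (hs : σ = 0 → h2 = 0) (he : 0 < e0) :
    ∃ κ K : ℝ, 0 < κ ∧ ∀ t u : ℝ, κ * (u ^ 4 + t ^ 2) - K ≤
      (δ * u ^ 4 + σ * t ^ 2 * u ^ 2) + (h2 * t * u ^ 2 + h3 * u ^ 3)
        + (e0 * t ^ 2 + e1 * t * u + e2 * u ^ 2) + (l0 * t + l1 * u) := by
  obtain ⟨c, hc⟩ : ∃ c : ℝ, ∀ t u : ℝ, -c * u ^ 2 ≤ σ * t ^ 2 * u ^ 2 + h2 * t * u ^ 2 := by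
    rcases hσ.eq_or_lt with h | h
    · refine ⟨0, fun t u => ?_⟩
      rw [hs h.symm, ← h]; simp
    · refine ⟨h2 ^ 2 / (4 * σ), fun t u => ?_⟩
      have : σ * t ^ 2 * u ^ 2 + h2 * t * u ^ 2 + h2 ^ 2 / (4 * σ) * u ^ 2
          = u ^ 2 / (4 * σ) * (2 * σ * t + h2) ^ 2 := by
        field_simp; ring
      have h' : 0 ≤ u ^ 2 / (4 * σ) * (2 * σ * t + h2) ^ 2 := by positivity
      linarith
  obtain ⟨K, hK⟩ := quartic_bound δ h3 (c + e1 ^ 2 / e0 - e2) l1 hδ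
  refine ⟨min (δ / 2) (e0 / 2), K + l0 ^ 2 / e0, lt_min (by linarith) (by linarith), fun t u => ?_⟩
  have a1 := hc t u
  have a2 := hK u
  have a3 : -(e0 / 4) * t ^ 2 - e1 ^ 2 / e0 * u ^ 2 ≤ e1 * t * u := by
    have : e1 * t * u + (e0 / 4) * t ^ 2 + e1 ^ 2 / e0 * u ^ 2
        = 1 / (4 * e0) * (e0 * t + 2 * e1 * u) ^ 2 := by
      field_simp; ring
    have h' : 0 ≤ 1 / (4 * e0) * (e0 * t + 2 * e1 * u) ^ 2 := by positivity
    linarith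
  have a4 : -(e0 / 4) * t ^ 2 - l0 ^ 2 / e0 ≤ l0 * t := by
    have : l0 * t + (e0 / 4) * t ^ 2 + l0 ^ 2 / e0
        = 1 / (4 * e0) * (e0 * t + 2 * l0) ^ 2 := by
      field_simp; ring
    have h' : 0 ≤ 1 / (4 * e0) * (e0 * t + 2 * l0) ^ 2 := by positivity
    linarith
  have a5 : min (δ / 2) (e0 / 2) * u ^ 4 ≤ δ / 2 * u ^ 4 := by
    gcongr; exact min_le_left _ _
  have a6 : min (δ / 2) (e0 / 2) * t ^ 2 ≤ e0 / 2 * t ^ 2 := by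
    gcongr; exact min_le_right _ _
  have a7 : (c + e1 ^ 2 / e0 - e2) * u ^ 2 = c * u ^ 2 + e1 ^ 2 / e0 * u ^ 2 - e2 * u ^ 2 := by ring
  linarith

lemma quad_definite (a b c : ℝ) (hc : 0 ≤ c) (h : b ^ 2 < 4 * a * c) :
    ∃ δ : ℝ, 0 < δ ∧ ∀ t u : ℝ, δ * (t ^ 2 + u ^ 2) ≤ a * t ^ 2 + b * t * u + c * u ^ 2 := by
  have hc' : 0 < c := by
    rcases hc.eq_or_lt with h0 | h0
    · rw [← h0] at h; nlinarith [sq_nonneg b]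
    · exact h0
  have ha : 0 < a := by
    by_contra h'
    push Not at h'
    nlinarith [sq_nonneg b, mul_nonneg (neg_nonneg.mpr h') hc'.le]
  have hac : 0 < a + c := by linarith
  refine ⟨(4 * a * c - b ^ 2) / (4 * (a + c)), by apply div_pos <;> linarith, fun t u => ?_⟩
  rw [div_mul_eq_mul_div, div_le_iff₀ (by linarith)]
  nlinarith [sq_nonneg (2 * a * t + b * u), sq_nonneg (b * t + 2 * c * u)]

lemma rat_quartic (a0 a1 : ℤ) (k c s : ℝ) (hk : k ≠ 0) (hcs : s ^ 2 + c ^ 2 = 1)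
    (h0 : (a0 : ℝ) = k * s ^ 4) (h1 : (a1 : ℝ) = -4 * k * s ^ 3 * c) :
    ∃ (m n : ℤ) (ρ : ℝ), ρ ≠ 0 ∧ (m : ℝ) = ρ * c ∧ (n : ℝ) = ρ * s := by
  by_cases hs : s = 0
  · subst hs
    have hc : c ≠ 0 := by rintro rfl; norm_num at hcs
    exact ⟨1, 0, c⁻¹, inv_ne_zero hc, by simp [hc], by simp⟩
  · refine ⟨-a1, 4 * a0, 4 * k * s ^ 3, by positivity, ?_, ?_⟩
    · push_cast; rw [h1]; ring
    · push_cast; rw [h0]; ring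

lemma rat_cubic (b0 b1 b2 b3 : ℤ) (α β c s : ℝ) (hcs : s ^ 2 + c ^ 2 = 1)
    (hne : α ≠ 0 ∨ β ≠ 0)
    (h0 : (b0 : ℝ) = s ^ 2 * α) (h1 : (b1 : ℝ) = s ^ 2 * β - 2 * s * c * α)
    (h2 : (b2 : ℝ) = c ^ 2 * α - 2 * s * c * β) (h3 : (b3 : ℝ) = c ^ 2 * β) :
    ∃ (m n : ℤ) (ρ : ℝ), ρ ≠ 0 ∧ (m : ℝ) = ρ * c ∧ (n : ℝ) = ρ * s := by
  by_cases hs : s = 0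
  · subst hs
    have hc : c ≠ 0 := by rintro rfl; norm_num at hcs
    exact ⟨1, 0, c⁻¹, inv_ne_zero hc, by simp [hc], by simp⟩
  · by_cases hw : s * β + c * α = 0
    · have hα : α ≠ 0 := by
        rintro rfl
        have : β = 0 := by simpa [hs] using hw
        simp [this] at hne
      refine ⟨-b1, 3 * b0, 3 * s * α, by positivity, ?_, ?_⟩
      · push_cast; rw [h1]; linear_combination (-s) * hw
      · push_cast; rw [h0]; ring
    · refine ⟨-(b1 * b2 - 9 * b0 * b3), 2 * (b1 ^ 2 - 3 * b0 * b2),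
        2 * s * (s * β + c * α) ^ 2, by positivity, ?_, ?_⟩
      · push_cast; rw [h0, h1, h2, h3]; ring
      · push_cast; rw [h0, h1, h2]; ring

/-- The counting step. -/
lemma count_bound (F : MvPolynomial (Fin 2) ℤ) (m n : ℤ) (κ₁ κ₂ K : ℝ) (h1 : 0 < κ₁) (h2 : 0 < κ₂)
    (hmn : m ^ 2 + n ^ 2 ≠ 0)
    (hF : ∀ x y : ℤ, κ₁ * ((n * x - m * y : ℤ) : ℝ) ^ 4 + κ₂ * ((m * x + n * y : ℤ) : ℝ) ^ 2 - K
      ≤ ((MvPolynomial.eval ![x, y] F : ℤ) : ℝ)) :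
    ∃ lam c : ℝ, 0 < lam ∧ 0 < c ∧ ∀ᶠ N : ℕ in Filter.atTop,
      ({m : ℤ | (N : ℤ) ≤ m ∧ m ≤ 2 * N ∧ m ∈ valueSet F}.ncard : ℝ)
        ≤ c * (N : ℝ) ^ (1 - lam) := by
  set C : ℝ := (2 + |K|) * (1 / κ₁ + 1 / κ₂) + 1 with hC
  have hC1 : 1 ≤ C := by
    have : 0 ≤ (2 + |K|) * (1 / κ₁ + 1 / κ₂) := by positivity
    linarith
  refine ⟨1 / 4, 9 * C ^ (3 / 4 : ℝ), by norm_num, by positivity, ?_⟩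
  filter_upwards [Filter.eventually_ge_atTop 1] with N hN
  have hN1 : (1 : ℝ) ≤ N := by exact_mod_cast hN
  have hCN : 1 ≤ C * N := by nlinarith
  have hCN0 : 0 ≤ C * N := by linarith
  set A : ℝ := (C * N) ^ (1 / 4 : ℝ) with hA
  set B : ℝ := (C * N) ^ (1 / 2 : ℝ) with hB
  have hA1 : 1 ≤ A := Real.one_le_rpow hCN (by norm_num)
  have hB1 : 1 ≤ B := Real.one_le_rpow hCN (by norm_num)
  have hA4 : A ^ 4 = C * N := by
    rw [hA, ← Real.rpow_natCast, ← Real.rpow_mul hCN0]; norm_num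
  have hB2 : B ^ 2 = C * N := by
    rw [hB, ← Real.rpow_natCast, ← Real.rpow_mul hCN0]; norm_num
  have hAB : A * B = (C * N) ^ (3 / 4 : ℝ) := by
    rw [hA, hB, ← Real.rpow_add (by linarith)]; norm_num
  set S := {m : ℤ | (N : ℤ) ≤ m ∧ m ≤ 2 * N ∧ m ∈ valueSet F} with hS
  set box : Finset (ℤ × ℤ) := Finset.Icc (-⌊A⌋) ⌊A⌋ ×ˢ Finset.Icc (-⌊B⌋) ⌊B⌋ with hbox
  have hex : ∀ v : ℤ, v ∈ S → ∃ z : ℤ × ℤ, MvPolynomial.eval ![z.1, z.2] F = v := by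
    rintro v ⟨_, _, x, y, h⟩
    exact ⟨(x, y), h⟩
  choose! z hz using hex
  have hcard : S.ncard ≤ (box : Set (ℤ × ℤ)).ncard := by
    apply Set.ncard_le_ncard_of_injOn
      (fun v => (n * (z v).1 - m * (z v).2, m * (z v).1 + n * (z v).2)) _ _ box.finite_toSet
    · intro v hv
      have hb := hF (z v).1 (z v).2
      rw [hz v hv] at hb
      have hv2 : (v : ℝ) ≤ 2 * N := by exact_mod_cast hv.2.1
      have hKK : 2 * (N : ℝ) + K ≤ (2 + |K|) * N := by
        have := le_abs_self K
        nlinarith [abs_nonneg K]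
      set U : ℤ := n * (z v).1 - m * (z v).2
      set T : ℤ := m * (z v).1 + n * (z v).2
      have hU4 : (U : ℝ) ^ 4 ≤ C * N := by
        have h3 : κ₁ * (U : ℝ) ^ 4 ≤ (2 + |K|) * N := by
          have : 0 ≤ κ₂ * (T : ℝ) ^ 2 := by positivity
          linarith
        have h4 : (U : ℝ) ^ 4 ≤ (2 + |K|) * N / κ₁ := by rwa [le_div_iff₀' h1]
        have h5 : C * N = (2 + |K|) * N / κ₁ + (2 + |K|) * N / κ₂ + N := by rw [hC]; ring
        have h6 : 0 ≤ (2 + |K|) * N / κ₂ := by positivity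
        linarith
      have hT2 : (T : ℝ) ^ 2 ≤ C * N := by
        have h3 : κ₂ * (T : ℝ) ^ 2 ≤ (2 + |K|) * N := by
          have : 0 ≤ κ₁ * (U : ℝ) ^ 4 := by positivity
          linarith
        have h4 : (T : ℝ) ^ 2 ≤ (2 + |K|) * N / κ₂ := by rwa [le_div_iff₀' h2]
        have h5 : C * N = (2 + |K|) * N / κ₁ + (2 + |K|) * N / κ₂ + N := by rw [hC]; ring
        have h6 : 0 ≤ (2 + |K|) * N / κ₁ := by positivity
        linarith
      have hUA : |(U : ℝ)| ≤ A := by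
        apply le_of_pow_le_pow_left₀ (n := 4) (by norm_num) (by linarith)
        rw [hA4, Even.pow_abs (by decide)]; exact hU4
      have hTB : |(T : ℝ)| ≤ B := by
        apply le_of_pow_le_pow_left₀ (n := 2) (by norm_num) (by linarith)
        rw [hB2, sq_abs]; exact hT2
      have hfl : ∀ (V : ℤ) (R : ℝ), |(V : ℝ)| ≤ R → -⌊R⌋ ≤ V ∧ V ≤ ⌊R⌋ := by
        intro V R hV
        rw [abs_le] at hV
        have h8 : -V ≤ ⌊R⌋ := Int.le_floor.mpr (by push_cast; linarith)
        exact ⟨by omega, Int.le_floor.mpr hV.2⟩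
      show (U, T) ∈ (box : Set (ℤ × ℤ))
      simp only [hbox, Finset.coe_product, Set.mem_prod, Finset.coe_Icc, Set.mem_Icc]
      exact ⟨hfl _ _ hUA, hfl _ _ hTB⟩
    · intro v hv w hw hvw
      simp only [Prod.mk.injEq] at hvw
      obtain ⟨e1, e2⟩ := hvw
      have hx : (z v).1 = (z w).1 := by
        apply mul_left_cancel₀ hmn
        linear_combination n * e1 + m * e2
      have hy : (z v).2 = (z w).2 := by
        apply mul_left_cancel₀ hmn
        linear_combination (-m) * e1 + n * e2
      rw [← hz v hv, ← hz w hw, hx, hy]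
  rw [Set.ncard_coe_finset, hbox, Finset.card_product] at hcard
  have hIcc : ∀ R : ℝ, 1 ≤ R → ((Finset.Icc (-⌊R⌋) ⌊R⌋).card : ℝ) ≤ 3 * R := by
    intro R hR
    have h0 : 0 ≤ ⌊R⌋ := Int.floor_nonneg.mpr (by linarith)
    have : ((Finset.Icc (-⌊R⌋) ⌊R⌋).card : ℤ) = 2 * ⌊R⌋ + 1 := by
      rw [Int.card_Icc, Int.toNat_of_nonneg (by omega)]; ring
    have h' : ((Finset.Icc (-⌊R⌋) ⌊R⌋).card : ℝ) = 2 * (⌊R⌋ : ℝ) + 1 := by exact_mod_cast this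
    rw [h']
    have := Int.floor_le R
    linarith
  calc (S.ncard : ℝ) ≤ ((Finset.Icc (-⌊A⌋) ⌊A⌋).card : ℝ) * ((Finset.Icc (-⌊B⌋) ⌊B⌋).card : ℝ) := by
        exact_mod_cast hcard
    _ ≤ (3 * A) * (3 * B) := by
        apply mul_le_mul (hIcc A hA1) (hIcc B hB1) (by positivity) (by linarith)
    _ = 9 * (A * B) := by ring
    _ = 9 * C ^ (3 / 4 : ℝ) * (N : ℝ) ^ (1 - 1 / 4 : ℝ) := by
        rw [hAB, Real.mul_rpow (by linarith) (by linarith)]; norm_num; ring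

lemma rot4 (a0 a1 a2 a3 a4 c s : ℝ) : ∃ g0 g1 g2 g3 g4 : ℝ, ∀ t u : ℝ,
    a0 * (c * t + s * u) ^ 4 * (s * t - c * u) ^ 0 + a1 * (c * t + s * u) ^ 3 * (s * t - c * u) ^ 1 + a2 * (c * t + s * u) ^ 2 * (s * t - c * u) ^ 2 + a3 * (c * t + s * u) ^ 1 * (s * t - c * u) ^ 3 + a4 * (c * t + s * u) ^ 0 * (s * t - c * u) ^ 4
      = g0 * t ^ 4 * u ^ 0 + g1 * t ^ 3 * u ^ 1 + g2 * t ^ 2 * u ^ 2 + g3 * t ^ 1 * u ^ 3 + g4 * t ^ 0 * u ^ 4 := by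
  refine ⟨(1) * a0 * c ^ 4 * s ^ 0 + (1) * a1 * c ^ 3 * s ^ 1 + (1) * a2 * c ^ 2 * s ^ 2 + (1) * a3 * c ^ 1 * s ^ 3 + (1) * a4 * c ^ 0 * s ^ 4,
    (4) * a0 * c ^ 3 * s ^ 1 + (-1) * a1 * c ^ 4 * s ^ 0 + (3) * a1 * c ^ 2 * s ^ 2 + (-2) * a2 * c ^ 3 * s ^ 1 + (2) * a2 * c ^ 1 * s ^ 3 + (-3) * a3 * c ^ 2 * s ^ 2 + (1) * a3 * c ^ 0 * s ^ 4 + (-4) * a4 * c ^ 1 * s ^ 3,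
    (6) * a0 * c ^ 2 * s ^ 2 + (-3) * a1 * c ^ 3 * s ^ 1 + (3) * a1 * c ^ 1 * s ^ 3 + (1) * a2 * c ^ 4 * s ^ 0 + (-4) * a2 * c ^ 2 * s ^ 2 + (1) * a2 * c ^ 0 * s ^ 4 + (3) * a3 * c ^ 3 * s ^ 1 + (-3) * a3 * c ^ 1 * s ^ 3 + (6) * a4 * c ^ 2 * s ^ 2,
    (4) * a0 * c ^ 1 * s ^ 3 + (-3) * a1 * c ^ 2 * s ^ 2 + (1) * a1 * c ^ 0 * s ^ 4 + (2) * a2 * c ^ 3 * s ^ 1 + (-2) * a2 * c ^ 1 * s ^ 3 + (-1) * a3 * c ^ 4 * s ^ 0 + (3) * a3 * c ^ 2 * s ^ 2 + (-4) * a4 * c ^ 3 * s ^ 1,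
    (1) * a0 * c ^ 0 * s ^ 4 + (-1) * a1 * c ^ 1 * s ^ 3 + (1) * a2 * c ^ 2 * s ^ 2 + (-1) * a3 * c ^ 3 * s ^ 1 + (1) * a4 * c ^ 4 * s ^ 0, fun t u => ?_⟩
  ring

lemma rot3 (b0 b1 b2 b3 c s : ℝ) : ∃ g0 g1 g2 g3 : ℝ, ∀ t u : ℝ,
    b0 * (c * t + s * u) ^ 3 * (s * t - c * u) ^ 0 + b1 * (c * t + s * u) ^ 2 * (s * t - c * u) ^ 1 + b2 * (c * t + s * u) ^ 1 * (s * t - c * u) ^ 2 + b3 * (c * t + s * u) ^ 0 * (s * t - c * u) ^ 3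
      = g0 * t ^ 3 * u ^ 0 + g1 * t ^ 2 * u ^ 1 + g2 * t ^ 1 * u ^ 2 + g3 * t ^ 0 * u ^ 3 := by
  refine ⟨(1) * b0 * c ^ 3 * s ^ 0 + (1) * b1 * c ^ 2 * s ^ 1 + (1) * b2 * c ^ 1 * s ^ 2 + (1) * b3 * c ^ 0 * s ^ 3,
    (3) * b0 * c ^ 2 * s ^ 1 + (-1) * b1 * c ^ 3 * s ^ 0 + (2) * b1 * c ^ 1 * s ^ 2 + (-2) * b2 * c ^ 2 * s ^ 1 + (1) * b2 * c ^ 0 * s ^ 3 + (-3) * b3 * c ^ 1 * s ^ 2,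
    (3) * b0 * c ^ 1 * s ^ 2 + (-2) * b1 * c ^ 2 * s ^ 1 + (1) * b1 * c ^ 0 * s ^ 3 + (1) * b2 * c ^ 3 * s ^ 0 + (-2) * b2 * c ^ 1 * s ^ 2 + (3) * b3 * c ^ 2 * s ^ 1,
    (1) * b0 * c ^ 0 * s ^ 3 + (-1) * b1 * c ^ 1 * s ^ 2 + (1) * b2 * c ^ 2 * s ^ 1 + (-1) * b3 * c ^ 3 * s ^ 0, fun t u => ?_⟩
  ring

lemma rot2 (e0 e1 e2 c s : ℝ) : ∃ g0 g1 g2 : ℝ, ∀ t u : ℝ,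
    e0 * (c * t + s * u) ^ 2 * (s * t - c * u) ^ 0 + e1 * (c * t + s * u) ^ 1 * (s * t - c * u) ^ 1 + e2 * (c * t + s * u) ^ 0 * (s * t - c * u) ^ 2
      = g0 * t ^ 2 * u ^ 0 + g1 * t ^ 1 * u ^ 1 + g2 * t ^ 0 * u ^ 2 := by
  refine ⟨(1) * e0 * c ^ 2 * s ^ 0 + (1) * e1 * c ^ 1 * s ^ 1 + (1) * e2 * c ^ 0 * s ^ 2,
    (2) * e0 * c ^ 1 * s ^ 1 + (-1) * e1 * c ^ 2 * s ^ 0 + (1) * e1 * c ^ 0 * s ^ 2 + (-2) * e2 * c ^ 1 * s ^ 1,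
    (1) * e0 * c ^ 0 * s ^ 2 + (-1) * e1 * c ^ 1 * s ^ 1 + (1) * e2 * c ^ 2 * s ^ 0, fun t u => ?_⟩
  ring

lemma rot1 (l0 l1 c s : ℝ) : ∃ g0 g1 : ℝ, ∀ t u : ℝ,
    l0 * (c * t + s * u) ^ 1 * (s * t - c * u) ^ 0 + l1 * (c * t + s * u) ^ 0 * (s * t - c * u) ^ 1
      = g0 * t ^ 1 * u ^ 0 + g1 * t ^ 0 * u ^ 1 := by
  refine ⟨(1) * l0 * c ^ 1 * s ^ 0 + (1) * l1 * c ^ 0 * s ^ 1,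
    (1) * l0 * c ^ 0 * s ^ 1 + (-1) * l1 * c ^ 1 * s ^ 0, fun t u => ?_⟩
  ring

lemma rot_hom4 {G : MvPolynomial (Fin 2) ℤ} (hG : G.IsHomogeneous 4) (c s : ℝ) :
    ∃ g0 g1 g2 g3 g4 : ℝ, ∀ t u : ℝ, evalReal G (c * t + s * u) (s * t - c * u) =
      g0 * t ^ 4 + g1 * t ^ 3 * u + g2 * t ^ 2 * u ^ 2 + g3 * t * u ^ 3 + g4 * u ^ 4 := by
  obtain ⟨a, ha⟩ := evalReal_hom hG
  obtain ⟨g0, g1, g2, g3, g4, h⟩ := rot4 (a 0) (a 1) (a 2) (a 3) (a 4) c s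
  refine ⟨g0, g1, g2, g3, g4, fun t u => ?_⟩
  rw [ha]
  simp only [Finset.sum_range_succ, Finset.sum_range_zero]
  norm_num at h ⊢
  linarith [h t u]

lemma rot_hom3 {G : MvPolynomial (Fin 2) ℤ} (hG : G.IsHomogeneous 3) (c s : ℝ) :
    ∃ g0 g1 g2 g3 : ℝ, ∀ t u : ℝ, evalReal G (c * t + s * u) (s * t - c * u) =
      g0 * t ^ 3 + g1 * t ^ 2 * u + g2 * t * u ^ 2 + g3 * u ^ 3 := by
  obtain ⟨a, ha⟩ := evalReal_hom hG
  obtain ⟨g0, g1, g2, g3, h⟩ := rot3 (a 0) (a 1) (a 2) (a 3) c s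
  refine ⟨g0, g1, g2, g3, fun t u => ?_⟩
  rw [ha]
  simp only [Finset.sum_range_succ, Finset.sum_range_zero]
  norm_num at h ⊢
  linarith [h t u]

lemma rot_hom2 {G : MvPolynomial (Fin 2) ℤ} (hG : G.IsHomogeneous 2) (c s : ℝ) :
    ∃ g0 g1 g2 : ℝ, ∀ t u : ℝ, evalReal G (c * t + s * u) (s * t - c * u) =
      g0 * t ^ 2 + g1 * t * u + g2 * u ^ 2 := by
  obtain ⟨a, ha⟩ := evalReal_hom hG
  obtain ⟨g0, g1, g2, h⟩ := rot2 (a 0) (a 1) (a 2) c s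
  refine ⟨g0, g1, g2, fun t u => ?_⟩
  rw [ha]
  simp only [Finset.sum_range_succ, Finset.sum_range_zero]
  norm_num at h ⊢
  linarith [h t u]

lemma rot_hom1 {G : MvPolynomial (Fin 2) ℤ} (hG : G.IsHomogeneous 1) (c s : ℝ) :
    ∃ g0 g1 : ℝ, ∀ t u : ℝ, evalReal G (c * t + s * u) (s * t - c * u) =
      g0 * t + g1 * u := by
  obtain ⟨a, ha⟩ := evalReal_hom hG
  obtain ⟨g0, g1, h⟩ := rot1 (a 0) (a 1) c s
  refine ⟨g0, g1, fun t u => ?_⟩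
  rw [ha]
  simp only [Finset.sum_range_succ, Finset.sum_range_zero]
  norm_num at h ⊢
  linarith [h t u]

lemma unrot (f : ℝ → ℝ → ℝ) (g : ℝ → ℝ → ℝ) (ξ : ℝ)
    (h : ∀ t u, f (Real.cos ξ * t + Real.sin ξ * u) (Real.sin ξ * t - Real.cos ξ * u) = g t u)
    (x y : ℝ) :
    f x y = g (Real.cos ξ * x + Real.sin ξ * y) (Real.sin ξ * x - Real.cos ξ * y) := by
  rw [← h]
  have := Real.sin_sq_add_cos_sq ξ
  congr 1
  · linear_combination (-x) * this
  · linear_combination (-y) * this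

lemma local_form (F4 F3 : MvPolynomial (Fin 2) ℤ) (h4 : F4.IsHomogeneous 4)
    (h3 : F3.IsHomogeneous 3) (hF4 : F4 ≠ 0) (hpsd : PosSemidef2 F4) (ξ : ℝ)
    (hz4 : evalReal F4 (Real.cos ξ) (Real.sin ξ) = 0)
    (hz3 : evalReal F3 (Real.cos ξ) (Real.sin ξ) = 0)
    (hrs : ∀ r s : ℕ,
        (linForm ξ ^ (2 * r) ∣ toR F4 ∧ ¬ linForm ξ ^ (2 * r + 1) ∣ toR F4) →
        (linForm ξ ^ s ∣ toR F3 ∧ ¬ linForm ξ ^ (s + 1) ∣ toR F3) → r ≠ s) :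
    ∃ g2 g3 g4 h1 h2 h3 : ℝ,
      (∀ t u : ℝ, evalReal F4 (Real.cos ξ * t + Real.sin ξ * u)
        (Real.sin ξ * t - Real.cos ξ * u) = g2 * t ^ 2 * u ^ 2 + g3 * t * u ^ 3 + g4 * u ^ 4) ∧
      (∀ t u : ℝ, evalReal F3 (Real.cos ξ * t + Real.sin ξ * u)
        (Real.sin ξ * t - Real.cos ξ * u) = h1 * t ^ 2 * u + h2 * t * u ^ 2 + h3 * u ^ 3) ∧
      0 ≤ g4 ∧ g3 ^ 2 ≤ 4 * g2 * g4 ∧ (g2 ≠ 0 → h1 = 0) ∧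
      (g2 = 0 → 0 < g4 ∧ g3 = 0 ∧ (h1 = 0 → h2 = 0)) := by
  obtain ⟨g0, g1, g2, g3, g4, hg⟩ := rot_hom4 h4 (Real.cos ξ) (Real.sin ξ)
  obtain ⟨k0, k1, k2, k3, hk⟩ := rot_hom3 h3 (Real.cos ξ) (Real.sin ξ)
  have hg0 : g0 = 0 := by
    have := hg 1 0
    simp [hz4] at this
    exact this.symm
  have hk0 : k0 = 0 := by
    have := hk 1 0
    simp [hz3] at this
    exact this.symm
  subst hg0 hk0
  obtain ⟨hg1, hg4, hdisc⟩ := psd_quartic g1 g2 g3 g4 (fun t u => by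
    have := hpsd (Real.cos ξ * t + Real.sin ξ * u) (Real.sin ξ * t - Real.cos ξ * u)
    rw [hg] at this
    linarith)
  subst hg1
  have hg' := unrot _ _ ξ hg
  have hk' := unrot _ _ ξ hk
  have hgP : ∀ u : ℝ, evalReal F4 (Real.cos ξ + Real.sin ξ * u) (Real.sin ξ - Real.cos ξ * u) =
      (Polynomial.C g2 * Polynomial.X ^ 2 + Polynomial.C g3 * Polynomial.X ^ 3
        + Polynomial.C g4 * Polynomial.X ^ 4).eval u := by
    intro u
    have := hg 1 u
    simp only [mul_one] at this
    rw [this]; simp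
  have hkP : ∀ u : ℝ, evalReal F3 (Real.cos ξ + Real.sin ξ * u) (Real.sin ξ - Real.cos ξ * u) =
      (Polynomial.C k1 * Polynomial.X ^ 1 + Polynomial.C k2 * Polynomial.X ^ 2
        + Polynomial.C k3 * Polynomial.X ^ 3).eval u := by
    intro u
    have := hk 1 u
    simp only [mul_one] at this
    rw [this]; simp
  have ndvd4 : ∀ k, linForm ξ ^ k ∣ toR F4 → ∀ j < k, (Polynomial.C g2 * Polynomial.X ^ 2
      + Polynomial.C g3 * Polynomial.X ^ 3 + Polynomial.C g4 * Polynomial.X ^ 4).coeff j = 0 := by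
    intro k hd
    exact Polynomial.X_pow_dvd_iff.mp (lin_dvd F4 ξ k _ hgP hd)
  have ndvd3 : ∀ k, linForm ξ ^ k ∣ toR F3 → ∀ j < k, (Polynomial.C k1 * Polynomial.X ^ 1
      + Polynomial.C k2 * Polynomial.X ^ 2 + Polynomial.C k3 * Polynomial.X ^ 3).coeff j = 0 := by
    intro k hd
    exact Polynomial.X_pow_dvd_iff.mp (lin_dvd F3 ξ k _ hkP hd)
  simp only [Polynomial.coeff_add, Polynomial.coeff_C_mul, Polynomial.coeff_X_pow] at ndvd4 ndvd3
  let T : MvPolynomial (Fin 2) ℝ := C (Real.cos ξ) * X 0 + C (Real.sin ξ) * X 1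
  let U : MvPolynomial (Fin 2) ℝ := linForm ξ
  have hT : ∀ x y, MvPolynomial.eval ![x, y] T = Real.cos ξ * x + Real.sin ξ * y := by
    intro x y; simp [T]
  have hU : ∀ x y, MvPolynomial.eval ![x, y] U = Real.sin ξ * x - Real.cos ξ * y := by
    intro x y; simp [U, linForm]
  refine ⟨g2, g3, g4, k1, k2, k3, fun t u => by rw [hg]; ring, fun t u => by rw [hk]; ring,
    hg4, hdisc, ?_, ?_⟩
  · intro hg2
    by_contra hk1
    refine hrs 1 1 ⟨?_, ?_⟩ ⟨?_, ?_⟩ rfl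
    · apply dvd_lin F4 ξ _ (C g2 * T ^ 2 + C g3 * T * U + C g4 * U ^ 2)
      intro x y
      rw [hg']; simp only [map_add, map_mul, map_pow, eval_C, hT, hU]; ring
    · intro hd
      have := ndvd4 _ hd 2 (by norm_num)
      simp at this
      exact hg2 this
    · apply dvd_lin F3 ξ _ (C k1 * T ^ 2 + C k2 * T * U + C k3 * U ^ 2)
      intro x y
      rw [hk']; simp only [map_add, map_mul, map_pow, eval_C, hT, hU]; ring
    · intro hd
      have := ndvd3 _ hd 1 (by norm_num)
      simp at this
      exact hk1 this
  · intro hg2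
    subst hg2
    have hg3 : g3 = 0 := by
      have : g3 ^ 2 ≤ 0 := by simpa using hdisc
      exact pow_eq_zero_iff (two_ne_zero) |>.mp (le_antisymm this (sq_nonneg _))
    subst hg3
    have hg4' : g4 ≠ 0 := by
      rintro rfl
      apply hF4
      apply eq_zero_of_evalReal
      intro x y
      rw [hg']; ring
    refine ⟨lt_of_le_of_ne hg4 hg4'.symm, rfl, ?_⟩
    intro hk1
    subst hk1
    by_contra hk2
    refine hrs 2 2 ⟨?_, ?_⟩ ⟨?_, ?_⟩ rfl
    · apply dvd_lin F4 ξ _ (C g4)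
      intro x y
      rw [hg']; simp only [eval_C]; ring
    · intro hd
      have := ndvd4 _ hd 4 (by norm_num)
      simp at this
      exact hg4' this
    · apply dvd_lin F3 ξ _ (C k2 * T + C k3 * U)
      intro x y
      rw [hk']; simp only [map_add, map_mul, eval_C, hT, hU]; ring
    · intro hd
      have := ndvd3 _ hd 2 (by norm_num)
      simp at this
      exact hk2 this

lemma evalReal_decomp (F : MvPolynomial (Fin 2) ℤ) (hdeg : F.totalDegree = 4)
    (h0 : MvPolynomial.eval ![0, 0] F = 0) (x y : ℝ) :
    evalReal F x y = evalReal (homogeneousComponent 4 F) x y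
      + evalReal (homogeneousComponent 3 F) x y + evalReal (homogeneousComponent 2 F) x y
      + evalReal (homogeneousComponent 1 F) x y := by
  have hc : coeff 0 F = 0 := by
    rw [← h0]
    have : (![0, 0] : Fin 2 → ℤ) = 0 := by ext i; fin_cases i <;> rfl
    rw [this, ← MvPolynomial.constantCoeff_eq]
    simp [MvPolynomial.eval_zero]
  have hs := sum_homogeneousComponent F
  rw [hdeg] at hs
  simp only [Finset.sum_range_succ, Finset.sum_range_zero, homogeneousComponent_zero, hc,
    C_0, zero_add] at hs
  conv_lhs => rw [← hs]
  simp only [evalReal, map_add]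
  ring

lemma comp4_ne_zero (F : MvPolynomial (Fin 2) ℤ) (hdeg : F.totalDegree = 4) :
    homogeneousComponent 4 F ≠ 0 := by
  intro h
  have hne : F.support.Nonempty := by
    rw [Finset.nonempty_iff_ne_empty]
    intro he
    rw [MvPolynomial.support_eq_empty] at he
    rw [he] at hdeg; simp at hdeg
  obtain ⟨d, hd, hd2⟩ := Finset.exists_mem_eq_sup F.support hne (fun s => s.sum fun _ e => e)
  have hd4 : d.degree = 4 := by
    rw [← hdeg, totalDegree, hd2]; rfl
  have := congrArg (coeff d) h
  rw [coeff_homogeneousComponent, if_pos hd4] at this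
  exact (mem_support_iff.mp hd) (by simpa using this)

/-- **Proposition 3.8.**  Let `F ∈ ℤ[x,y]` be linked of degree 4 with
`F(0,0) = 0` and `F₃ ≠ 0`, suppose `F₂(cos ξ, sin ξ) > 0` for all `ξ ∈ Ξ`, and for each
`ξ ∈ Ξ` the numbers `r_ξ` (half the multiplicity of `sin(ξ)x - cos(ξ)y` in `F₄`) and
`s_ξ` (its multiplicity in `F₃`) satisfy `r_ξ ≠ s_ξ`.  Then either
`#ℛ_F([N,2N]) ≪ N^{1-λ}` for some `λ > 0`, or `inf_{(x,y) ∈ ℤ²} F(x,y) = -∞`. -/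
theorem linked_r_ne_s_density_or_inf
    (F : MvPolynomial (Fin 2) ℤ) (hdeg : F.totalDegree = 4)
    (h0 : MvPolynomial.eval ![0, 0] F = 0)
    (Ft4 : MvPolynomial (Fin 2) ℤ)
    (htilde : IsTildePart (MvPolynomial.homogeneousComponent 4 F) Ft4)
    (hpsd : PosSemidef2 (MvPolynomial.homogeneousComponent 4 F))
    (hgcd1 : CommonFactor2 Ft4 (MvPolynomial.homogeneousComponent 3 F))
    (hgcd2 : ¬ CommonFactor3 Ft4 (MvPolynomial.homogeneousComponent 3 F)
      (MvPolynomial.homogeneousComponent 2 F))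
    (hF3 : MvPolynomial.homogeneousComponent 3 F ≠ 0)
    (hF2pos : ∀ ξ : ℝ, ξ ∈ Set.Ico 0 (2 * Real.pi) →
      evalReal Ft4 (Real.cos ξ) (Real.sin ξ) = 0 →
      evalReal (MvPolynomial.homogeneousComponent 3 F) (Real.cos ξ) (Real.sin ξ) = 0 →
      0 < evalReal (MvPolynomial.homogeneousComponent 2 F) (Real.cos ξ) (Real.sin ξ))
    (hrs : ∀ ξ : ℝ, ξ ∈ Set.Ico 0 (2 * Real.pi) →
      evalReal Ft4 (Real.cos ξ) (Real.sin ξ) = 0 →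
      evalReal (MvPolynomial.homogeneousComponent 3 F) (Real.cos ξ) (Real.sin ξ) = 0 →
      ∀ r s : ℕ,
        (linForm ξ ^ (2 * r) ∣ toR (MvPolynomial.homogeneousComponent 4 F) ∧
          ¬ linForm ξ ^ (2 * r + 1) ∣ toR (MvPolynomial.homogeneousComponent 4 F)) →
        (linForm ξ ^ s ∣ toR (MvPolynomial.homogeneousComponent 3 F) ∧
          ¬ linForm ξ ^ (s + 1) ∣ toR (MvPolynomial.homogeneousComponent 3 F)) →
        r ≠ s) :
    (∃ lam c : ℝ, 0 < lam ∧ 0 < c ∧ ∀ᶠ N : ℕ in Filter.atTop,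
      ({m : ℤ | (N : ℤ) ≤ m ∧ m ≤ 2 * N ∧ m ∈ valueSet F}.ncard : ℝ)
        ≤ c * (N : ℝ) ^ (1 - lam)) ∨
    (∀ M : ℤ, ∃ x y : ℤ, MvPolynomial.eval ![x, y] F < -M) := by
  classical
  set F4 := homogeneousComponent 4 F with hF4def
  set F3 := homogeneousComponent 3 F with hF3def
  set F2 := homogeneousComponent 2 F with hF2def
  set F1 := homogeneousComponent 1 F with hF1def
  have hom4 : F4.IsHomogeneous 4 := homogeneousComponent_isHomogeneous 4 F
  have hom3 : F3.IsHomogeneous 3 := homogeneousComponent_isHomogeneous 3 F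
  have hom2 : F2.IsHomogeneous 2 := homogeneousComponent_isHomogeneous 2 F
  have hom1 : F1.IsHomogeneous 1 := homogeneousComponent_isHomogeneous 1 F
  have hF4 : F4 ≠ 0 := comp4_ne_zero F hdeg
  have hdec := evalReal_decomp F hdeg h0
  rw [← hF4def, ← hF3def, ← hF2def, ← hF1def] at hdec
  have htilde' := htilde
  obtain ⟨P0, kP, hP0, hP0pd, hFP, ⟨nt, hnt⟩, -, -⟩ := htilde'
  -- reduction of the second alternative to real evaluations
  have hneg : (∀ M : ℝ, ∃ x y : ℤ, evalReal F x y < M) →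
      ∀ M : ℤ, ∃ x y : ℤ, MvPolynomial.eval ![x, y] F < -M := by
    intro h M
    obtain ⟨x, y, hxy⟩ := h (-M)
    refine ⟨x, y, ?_⟩
    rw [evalReal_int] at hxy
    exact_mod_cast hxy
  -- a direction in Ξ
  obtain ⟨x0, y0, hxy0, hx4, hx3⟩ := exists_common_dir F4 Ft4 F3 hF4 htilde hgcd1
  obtain ⟨ξ, ρ0, hξ, hρ0, rfl, rfl⟩ := exists_angle x0 y0 hxy0
  have hzt : evalReal Ft4 (Real.cos ξ) (Real.sin ξ) = 0 := by
    rw [evalReal_scale hnt] at hx4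
    exact (mul_eq_zero.mp hx4).resolve_left (pow_ne_zero _ hρ0.ne')
  have hz3 : evalReal F3 (Real.cos ξ) (Real.sin ξ) = 0 := by
    rw [evalReal_scale hom3] at hx3
    exact (mul_eq_zero.mp hx3).resolve_left (pow_ne_zero _ hρ0.ne')
  have hz4 : evalReal F4 (Real.cos ξ) (Real.sin ξ) = 0 := by
    rw [hFP, evalReal_mul, hzt, mul_zero]
  have he0 := hF2pos ξ hξ hzt hz3
  obtain ⟨g2, g3, g4, h1, h2, h3, hg, hh, hg4, hdisc, hcase1, hcase2⟩ :=
    local_form F4 F3 hom4 hom3 hF4 hpsd ξ hz4 hz3 (hrs ξ hξ hzt hz3)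
  obtain ⟨e0, e1, e2, he⟩ := rot_hom2 hom2 (Real.cos ξ) (Real.sin ξ)
  obtain ⟨l0, l1, hl⟩ := rot_hom1 hom1 (Real.cos ξ) (Real.sin ξ)
  have he0' : 0 < e0 := by
    have := he 1 0
    simp at this
    rwa [this] at he0
  have hsc := Real.sin_sq_add_cos_sq ξ
  have hg' := unrot _ _ ξ hg
  have hh' := unrot _ _ ξ hh
  set c := Real.cos ξ with hc
  set s := Real.sin ξ with hs
  -- the counting conclusion from a rational direction and a lower bound for F₄ + F₃
  have hcount : ∀ (m n : ℤ) (ρ δ σ : ℝ), ρ ≠ 0 → (m : ℝ) = ρ * c → (n : ℝ) = ρ * s → 0 < δ → 0 ≤ σ →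
      (σ = 0 → h2 = 0) → h1 = 0 →
      (∀ t u : ℝ, δ * u ^ 4 + σ * t ^ 2 * u ^ 2 ≤ g2 * t ^ 2 * u ^ 2 + g3 * t * u ^ 3 + g4 * u ^ 4) →
      (∃ lam c : ℝ, 0 < lam ∧ 0 < c ∧ ∀ᶠ N : ℕ in Filter.atTop,
      ({m : ℤ | (N : ℤ) ≤ m ∧ m ≤ 2 * N ∧ m ∈ valueSet F}.ncard : ℝ)
        ≤ c * (N : ℝ) ^ (1 - lam)) := by
    intro m n ρ δ σ hρ hm hn hδ hσ hσ0 hh1 hQ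
    obtain ⟨κ, K, hκ, hb⟩ := lower_bound δ σ h2 h3 e0 e1 e2 l0 l1 hδ hσ hσ0 he0'
    apply count_bound F m n (κ / ρ ^ 4) (κ / ρ ^ 2) K (by positivity) (by positivity)
    · intro h
      have : (m : ℝ) ^ 2 + (n : ℝ) ^ 2 = 0 := by exact_mod_cast h
      rw [hm, hn] at this
      have h' : ρ ^ 2 = 0 := by linear_combination this - ρ ^ 2 * hsc
      exact hρ (pow_eq_zero_iff two_ne_zero |>.mp h')
    · intro x y
      rw [← evalReal_int, hdec, hg', hh', unrot _ _ ξ he, unrot _ _ ξ hl, ← hc, ← hs]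
      push_cast
      rw [hm, hn]
      set t := c * (x : ℝ) + s * y
      set u := s * (x : ℝ) - c * y
      have q1 : κ / ρ ^ 4 * (ρ * s * x - ρ * c * y) ^ 4 = κ * u ^ 4 := by
        have : ρ * s * x - ρ * c * y = ρ * u := by simp only [u]; ring
        rw [this]; field_simp
      have q2 : κ / ρ ^ 2 * (ρ * c * x + ρ * s * y) ^ 2 = κ * t ^ 2 := by
        have : ρ * c * x + ρ * s * y = ρ * t := by simp only [t]; ring
        rw [this]; field_simp
      rw [q1, q2]
      have b1 := hb t u
      have b2 := hQ t u
      rw [hh1]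
      linarith
  -- rationality gives points with prescribed rotated coordinates
  have hpt : ∀ (m n : ℤ) (ρ : ℝ), (m : ℝ) = ρ * c → (n : ℝ) = ρ * s → ∀ T U : ℤ,
      ((m * T + n * U : ℤ) : ℝ) = c * (ρ * T) + s * (ρ * U) ∧
      ((n * T - m * U : ℤ) : ℝ) = s * (ρ * T) - c * (ρ * U) := by
    intro m n ρ hm hn T U
    push_cast
    rw [hm, hn]
    constructor <;> ring
  by_cases hg2 : g2 = 0
  · -- F₄ = g4 L⁴
    obtain ⟨hg4p, hg3, hh12⟩ := hcase2 hg2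
    subst hg2 hg3
    obtain ⟨a, ha⟩ := evalReal_hom hom4
    have hA : ∀ x y : ℝ, a 0 * x ^ 4 + a 1 * x ^ 3 * y + a 2 * x ^ 2 * y ^ 2 + a 3 * x * y ^ 3
        + a 4 * y ^ 4 = g4 * (s * x - c * y) ^ 4 := by
      intro x y
      have e1 := ha x y
      rw [hg'] at e1
      simp only [Finset.sum_range_succ, Finset.sum_range_zero] at e1
      norm_num at e1
      linarith
    obtain ⟨m, n, ρ, hρ, hm, hn⟩ := rat_quartic (a 0) (a 1) g4 c s hg4p.ne' hsc
      (by linear_combination hA 1 0)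
      (by linear_combination (8 * (hA 1 1 - hA 1 (-1)) - (hA 1 2 - hA 1 (-2))) / 12)
    by_cases hh1 : h1 = 0
    · left
      refine hcount m n ρ g4 0 hρ hm hn hg4p le_rfl (fun _ => hh12 hh1) hh1 ?_
      intro t u
      linarith
    · right
      apply hneg
      intro M
      -- choose U with ρ h1 U + e0 < 0
      obtain ⟨U, hU⟩ : ∃ U : ℤ, h1 * ρ * U + e0 < 0 := by
        have hne : h1 * ρ ≠ 0 := mul_ne_zero hh1 hρ
        rcases lt_or_gt_of_ne hne with h | h
        · obtain ⟨U, hU⟩ := exists_int_gt (e0 / -(h1 * ρ))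
          refine ⟨U, ?_⟩
          rw [div_lt_iff₀ (by linarith)] at hU
          linarith
        · obtain ⟨U, hU⟩ := exists_int_lt (-e0 / (h1 * ρ))
          refine ⟨U, ?_⟩
          rw [lt_div_iff₀ h] at hU
          linarith
      obtain ⟨T, hT⟩ := neg_quad (ρ ^ 2 * (h1 * ρ * U + e0))
        (h2 * ρ ^ 3 * U ^ 2 + e1 * ρ ^ 2 * U + l0 * ρ)
        (g4 * (ρ * U) ^ 4 + h3 * (ρ * U) ^ 3 + e2 * (ρ * U) ^ 2 + l1 * (ρ * U))
        (mul_neg_of_pos_of_neg (by positivity) hU) M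
      refine ⟨m * T + n * U, n * T - m * U, ?_⟩
      obtain ⟨p1, p2⟩ := hpt m n ρ hm hn T U
      rw [p1, p2, hdec, hg, hh, he, hl]
      refine lt_of_eq_of_lt ?_ hT
      ring
  · -- F₃ = L² M
    have hh1 := hcase1 hg2
    subst hh1
    obtain ⟨b, hb⟩ := evalReal_hom hom3
    have hB : ∀ x y : ℝ, b 0 * x ^ 3 + b 1 * x ^ 2 * y + b 2 * x * y ^ 2 + b 3 * y ^ 3
        = (s * x - c * y) ^ 2 * (h2 * (c * x + s * y) + h3 * (s * x - c * y)) := by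
      intro x y
      have e1 := hb x y
      rw [hh'] at e1
      simp only [Finset.sum_range_succ, Finset.sum_range_zero] at e1
      norm_num at e1
      linarith
    have hne : h2 ≠ 0 ∨ h3 ≠ 0 := by
      by_contra hcon
      push Not at hcon
      apply hF3
      apply eq_zero_of_evalReal
      intro x y
      rw [hh', hcon.1, hcon.2]; ring
    obtain ⟨m, n, ρ, hρ, hm, hn⟩ := rat_cubic (b 0) (b 1) (b 2) (b 3) (h2 * c + h3 * s)
      (h2 * s - h3 * c) c s hsc
      (by
        by_contra hcon
        push Not at hcon
        have q1 : h2 = 0 := by linear_combination c * hcon.1 + s * hcon.2 - h2 * hsc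
        have q2 : h3 = 0 := by linear_combination s * hcon.1 - c * hcon.2 - h3 * hsc
        simp [q1, q2] at hne)
      (by linear_combination hB 1 0)
      (by linear_combination (hB 1 1 - hB 1 (-1)) / 2 - hB 0 1)
      (by linear_combination (hB 1 1 + hB 1 (-1)) / 2 - hB 1 0)
      (by linear_combination hB 0 1)
    rcases hdisc.lt_or_eq with hd | hd
    · -- definite cofactor
      left
      obtain ⟨δ, hδ, hq⟩ := quad_definite g2 g3 g4 hg4 hd
      refine hcount m n ρ δ δ hρ hm hn hδ hδ.le (fun h => absurd h hδ.ne') rfl ?_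
      intro t u
      have := mul_le_mul_of_nonneg_right (hq t u) (sq_nonneg u)
      linarith
    · -- F₄ = k L² M²
      have hint : ∀ T U : ℤ, ∃ v : ℤ, (v : ℝ) = ρ ^ 4 *
          (g2 * (T : ℝ) ^ 2 * (U : ℝ) ^ 2 + g3 * T * (U : ℝ) ^ 3 + g4 * (U : ℝ) ^ 4) := by
        intro T U
        refine ⟨MvPolynomial.eval ![m * T + n * U, n * T - m * U] F4, ?_⟩
        obtain ⟨p1, p2⟩ := hpt m n ρ hm hn T U
        rw [← evalReal_int, p1, p2, hg]
        ring
      obtain ⟨v0, hv0⟩ := hint 0 1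
      obtain ⟨v1, hv1⟩ := hint 1 1
      obtain ⟨v2, hv2⟩ := hint (-1) 1
      push_cast at hv0 hv1 hv2
      set T0 : ℤ := -(v1 - v2) with hT0
      set U0 : ℤ := 2 * (v1 + v2 - 2 * v0) with hU0
      have hT0r : (T0 : ℝ) = ρ ^ 4 * (-2 * g3) := by
        rw [hT0]; push_cast; rw [hv1, hv2]; ring
      have hU0r : (U0 : ℝ) = ρ ^ 4 * (4 * g2) := by
        rw [hU0]; push_cast; rw [hv0, hv1, hv2]; ring
      have hU0ne : (U0 : ℝ) ≠ 0 := by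
        rw [hU0r]; positivity
      set X0 : ℤ := m * T0 + n * U0 with hX0
      set Y0 : ℤ := n * T0 - m * U0 with hY0
      obtain ⟨p1, p2⟩ := hpt m n ρ hm hn T0 U0
      rw [← hX0] at p1
      rw [← hY0] at p2
      have hη4 : evalReal F4 X0 Y0 = 0 := by
        rw [p1, p2, hg, hT0r, hU0r]
        linear_combination (-(ρ ^ 20) * 64 * g2 ^ 3 * hd)
      by_cases hη3 : evalReal F3 X0 Y0 = 0
      · exfalso
        have hne0 : ((X0 : ℝ), (Y0 : ℝ)) ≠ (0, 0) := by
          intro h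
          simp only [Prod.mk.injEq] at h
          obtain ⟨q1, q2⟩ := h
          rw [p1] at q1
          rw [p2] at q2
          have : ρ * (U0 : ℝ) = 0 := by
            linear_combination s * q1 - c * q2 - ρ * U0 * hsc
          exact mul_ne_zero hρ hU0ne this
        have hηt : evalReal Ft4 X0 Y0 = 0 := by
          have := hη4
          rw [hFP, evalReal_mul] at this
          exact (mul_eq_zero.mp this).resolve_left (hP0pd _ _ hne0).ne'
        obtain ⟨η, ρ', hη, hρ', hXe, hYe⟩ := exists_angle X0 Y0 hne0
        have kt : evalReal Ft4 (Real.cos η) (Real.sin η) = 0 := by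
          rw [hXe, hYe, evalReal_scale hnt] at hηt
          exact (mul_eq_zero.mp hηt).resolve_left (pow_ne_zero _ hρ'.ne')
        have k3 : evalReal F3 (Real.cos η) (Real.sin η) = 0 := by
          rw [hXe, hYe, evalReal_scale hom3] at hη3
          exact (mul_eq_zero.mp hη3).resolve_left (pow_ne_zero _ hρ'.ne')
        have k4 : evalReal F4 (Real.cos η) (Real.sin η) = 0 := by
          rw [hFP, evalReal_mul, kt, mul_zero]
        obtain ⟨G2, G3, G4, H1, H2, H3, hG, hH, -, -, hC1, hC2⟩ :=
          local_form F4 F3 hom4 hom3 hF4 hpsd η k4 k3 (hrs η hη kt k3)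
        have hG' := unrot _ _ η hG
        have hH' := unrot _ _ η hH
        -- sin(η) cos(ξ) - cos(η) sin(ξ) ≠ 0
        have hcross : Real.sin η * c - Real.cos η * s ≠ 0 := by
          intro h
          apply mul_ne_zero hρ hU0ne
          rw [hXe] at p1
          rw [hYe] at p2
          linear_combination (-s) * p1 + c * p2 - ρ * U0 * hsc - ρ' * h
        have hG2 : G2 ≠ 0 := by
          intro h
          obtain ⟨r1, r2, -⟩ := hC2 h
          have := hG' c s
          rw [hz4, h, r2] at this
          have h5 : G4 * (Real.sin η * c - Real.cos η * s) ^ 4 = 0 := by linarith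
          exact mul_ne_zero r1.ne' (pow_ne_zero 4 hcross) h5
        have hH1 := hC1 hG2
        subst hH1
        -- restrict F₃ to the line (X0, Y0) + ε (c, s)
        have hline1 : ∀ ε : ℝ, evalReal F3 (X0 + ε * c) (Y0 + ε * s) =
            h2 * (ρ * T0 + ε) * (ρ * U0) ^ 2 + h3 * (ρ * U0) ^ 3 := by
          intro ε
          have q1 : (X0 : ℝ) + ε * c = c * (ρ * T0 + ε) + s * (ρ * U0) := by rw [p1]; ring
          have q2 : (Y0 : ℝ) + ε * s = s * (ρ * T0 + ε) - c * (ρ * U0) := by rw [p2]; ring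
          rw [q1, q2, hh]; ring
        obtain ⟨P, Q, hline2⟩ : ∃ P Q : ℝ, ∀ ε : ℝ, evalReal F3 (X0 + ε * c) (Y0 + ε * s) =
            P * ε ^ 2 + Q * ε ^ 3 := by
          set w := Real.sin η * c - Real.cos η * s
          set w2 := Real.cos η * c + Real.sin η * s
          refine ⟨H2 * w ^ 2 * ρ', H2 * w ^ 2 * w2 + H3 * w ^ 3, fun ε => ?_⟩
          rw [hH', hXe, hYe]
          have hsc' := Real.sin_sq_add_cos_sq η
          have q1 : Real.sin η * (ρ' * Real.cos η + ε * c) - Real.cos η * (ρ' * Real.sin η + ε * s)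
              = ε * w := by simp only [w]; ring
          have q2 : Real.cos η * (ρ' * Real.cos η + ε * c) + Real.sin η * (ρ' * Real.sin η + ε * s)
              = ρ' + ε * w2 := by
            simp only [w2]; linear_combination ρ' * hsc'
          rw [q1, q2]; ring
        have z0 := (hline1 0).symm.trans (hline2 0)
        have z1 := (hline1 1).symm.trans (hline2 1)
        have z2 := (hline1 (-1)).symm.trans (hline2 (-1))
        have z3 := (hline1 2).symm.trans (hline2 2)
        have hρU : ρ * (U0 : ℝ) ≠ 0 := mul_ne_zero hρ hU0ne
        have y2 : h2 * (ρ * U0) ^ 2 = 0 := by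
          linear_combination z1 - (1 / 3) * z2 - (1 / 6) * z3 - (1 / 2) * z0
        have y2' : h2 = 0 := (mul_eq_zero.mp y2).resolve_right (pow_ne_zero 2 hρU)
        have y3 : h3 * (ρ * U0) ^ 3 = 0 := by
          rw [y2'] at z0
          linear_combination z0
        have y3' : h3 = 0 := (mul_eq_zero.mp y3).resolve_right (pow_ne_zero 3 hρU)
        simp [y2', y3'] at hne
      · right
        apply hneg
        intro M
        obtain ⟨k, hk⟩ := neg_cubic (evalReal F3 X0 Y0) (evalReal F2 X0 Y0) (evalReal F1 X0 Y0)
          hη3 M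
        refine ⟨k * X0, k * Y0, ?_⟩
        push_cast
        rw [hdec, evalReal_scale hom4, evalReal_scale hom3, evalReal_scale hom2,
          evalReal_scale hom1, hη4]
        linarith
end
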